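/- arXiv:2412.09882 — 3 statements merged into one kernel-verified Lean document; each statement's English description precedes it below -/
import Mathlib

section
/- Let d > 1 and let μ_d be the measure r^{d−1}dr on (0,∞). Define R_2 f(r) = χ_{[0,4/3)}(r) · sup_{t∈[1,2], t≥3r/2} (1/r)·∫_{t−r}^{t+r} |f(s)| ds. Then R_2 is bounded from L^1(μ_d) to L^1(μ_d) and from L^1(μ_d) to weak-L^d(μ_d), and for 1 < p ≤ ∞ and p ≤ q ≤ pd, R_2 is bounded from L^p(μ_d) to L^q(μ_d). -/
open Set MeasureTheory
open scoped ENNReal NNReal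

noncomputable section

/-- The measure `μ_d` on `(0,∞)` with density `r^{d-1}`. -/
def mud (d : ℕ) : Measure ℝ :=
  (volume.restrict (Ioi (0 : ℝ))).withDensity fun r => ENNReal.ofReal (r ^ (d - 1))

/-- The `L^p(μ)` norm of an `ℝ≥0∞`-valued function (with `p = ∞` meaning the
essential supremum). -/
def lpNormE (μ : Measure ℝ) (p : ℝ≥0∞) (g : ℝ → ℝ≥0∞) : ℝ≥0∞ :=
  if p = ∞ then essSup g μ else (∫⁻ r, g r ^ p.toReal ∂μ) ^ (1 / p.toReal)

/-- `R₂ f(r) = χ_{[0,4/3)}(r) · sup_{t∈[1,2], t ≥ 3r/2} (1/r) ∫_{t−r}^{t+r} |f(s)| ds`. -/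
def R2 (f : ℝ → ℝ) (r : ℝ) : ℝ≥0∞ :=
  if 0 ≤ r ∧ r < 4 / 3 then
    ⨆ t ∈ {t : ℝ | t ∈ Icc (1 : ℝ) 2 ∧ 3 * r / 2 ≤ t},
      (ENNReal.ofReal r)⁻¹ * ∫⁻ s in Icc (t - r) (t + r), ENNReal.ofReal |f s|
  else 0


def sg : Measure ℝ := volume.restrict (Icc (1/3 : ℝ) (10/3))

def GG (f : ℝ → ℝ) (r : ℝ) : ℝ≥0∞ :=
  ⨆ t : ℝ, ∫⁻ s in Icc (t - r) (t + r), ENNReal.ofReal |f s| ∂sg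

lemma GG_mono (f : ℝ → ℝ) : Monotone (GG f) := by
  intro a b hab
  refine iSup_mono fun t => lintegral_mono_set ?_
  exact Icc_subset_Icc (by linarith) (by linarith)

lemma R2_le (f : ℝ → ℝ) (r : ℝ) : R2 f r ≤ (ENNReal.ofReal r)⁻¹ * GG f r := by
  unfold R2
  split_ifs with h
  · refine iSup₂_le fun t ht => ?_
    obtain ⟨⟨h1, h2⟩, h3⟩ := ht
    gcongr
    refine le_trans (le_of_eq ?_) (le_iSup _ t)
    unfold sg
    rw [Measure.restrict_restrict measurableSet_Icc, inter_eq_left.2]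
    exact Icc_subset_Icc (by linarith) (by linarith)
  · exact zero_le

lemma R2_zero (f : ℝ → ℝ) (r : ℝ) (hr : 4/3 ≤ r) : R2 f r = 0 := by
  unfold R2
  rw [if_neg]
  rintro ⟨_, h⟩
  linarith

lemma sg_le (d : ℕ) : sg ≤ ((3 : ℝ≥0∞) ^ (d-1)) • mud d := by
  refine Measure.le_iff.2 fun s hs => ?_
  rw [Measure.smul_apply, mud, withDensity_apply _ hs, smul_eq_mul, sg,
    Measure.restrict_restrict hs, Measure.restrict_apply hs,
    ← lintegral_const_mul' _ _ (by finiteness)]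
  have : s ∩ Icc (1/3 : ℝ) (10/3) ⊆ s ∩ Ioi 0 := by
    rintro x ⟨h1, h2, h3⟩
    exact ⟨h1, by simp only [mem_Ioi]; linarith⟩
  refine le_trans ?_ (lintegral_mono_set this)
  rw [← setLIntegral_one]
  refine setLIntegral_mono' (hs.inter measurableSet_Icc) ?_
  rintro x ⟨h1, h2, h3⟩
  have : (3 : ℝ≥0∞) = ENNReal.ofReal 3 := by norm_num
  rw [this, ← ENNReal.ofReal_pow (by norm_num), ← ENNReal.ofReal_mul (by positivity), ← mul_pow]
  rw [ENNReal.one_le_ofReal]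
  apply one_le_pow₀
  linarith

lemma sg_lintegral_le (d : ℕ) (g : ℝ → ℝ≥0∞) :
    ∫⁻ s, g s ∂sg ≤ (3 : ℝ≥0∞) ^ (d-1) * ∫⁻ s, g s ∂(mud d) := by
  refine le_trans (lintegral_mono' (sg_le d) le_rfl) ?_
  rw [lintegral_smul_measure, smul_eq_mul]

lemma sg_ac (d : ℕ) : sg ≪ mud d :=
  (Measure.absolutelyContinuous_of_le (sg_le d)).trans (Measure.smul_absolutelyContinuous)

lemma sg_Icc_le (t r : ℝ) : sg (Icc (t - r) (t + r)) ≤ ENNReal.ofReal (2 * r) := by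
  refine le_trans (Measure.restrict_apply_le _ _) ?_
  rw [Real.volume_Icc]
  apply le_of_eq; congr 1; ring

lemma GG_le_one (f : ℝ → ℝ) (r : ℝ) : GG f r ≤ ∫⁻ s, ENNReal.ofReal |f s| ∂sg :=
  iSup_le fun _ => setLIntegral_le_lintegral _ _

lemma GG_le_p (f : ℝ → ℝ) (hf : Measurable f) (p : ℝ) (hp : 1 < p) (r : ℝ) :
    GG f r ≤ (ENNReal.ofReal (2 * r)) ^ (1 - 1/p) *
      (∫⁻ s, ENNReal.ofReal |f s| ^ p ∂sg) ^ (1/p) := by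
  refine iSup_le fun t => ?_
  have hpq := Real.HolderConjugate.conjExponent hp
  have h := ENNReal.lintegral_mul_le_Lp_mul_Lq (sg.restrict (Icc (t - r) (t + r))) hpq
    (f := fun s => ENNReal.ofReal |f s|) (g := fun _ => 1)
    (by fun_prop) (by fun_prop)
  simp only [Pi.mul_apply, mul_one, ENNReal.one_rpow, lintegral_const, one_mul,
    Measure.restrict_apply_univ] at h
  have e : 1 / Real.conjExponent p = 1 - 1 / p := by
    have := hpq.inv_add_inv_eq_one
    simp only [one_div]; linarith
  have e2 : 0 ≤ 1 - 1 / p := by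
    have : 1 / p ≤ 1 := by rw [div_le_one (by linarith)]; linarith
    linarith
  rw [e] at h
  refine h.trans ?_
  rw [mul_comm]
  gcongr
  · exact sg_Icc_le t r
  · exact Measure.restrict_le_self

lemma GG_le_top (f : ℝ → ℝ) (d : ℕ) (r : ℝ) :
    GG f r ≤ ENNReal.ofReal (2 * r) * essSup (fun s => ENNReal.ofReal |f s|) (mud d) := by
  refine iSup_le fun t => ?_
  have h := (sg_ac d).ae_le (ENNReal.ae_le_essSup (μ := mud d) (fun s => ENNReal.ofReal |f s|))
  refine (lintegral_mono_ae (ae_restrict_of_ae h)).trans ?_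
  rw [lintegral_const, Measure.restrict_apply_univ, mul_comm]
  gcongr
  exact sg_Icc_le t r

lemma GG_le_split (f : ℝ → ℝ) (hf : Measurable f) (a r : ℝ) (ha : 0 ≤ a) (hr : 0 < r) :
    GG f r ≤ ENNReal.ofReal (2 * r * a) +
      (sg.withDensity (fun s => ENNReal.ofReal |f s|)) {s | a < |f s|} := by
  refine iSup_le fun t => ?_
  have hm : MeasurableSet {s | a < |f s|} := measurableSet_lt measurable_const hf.abs
  rw [withDensity_apply _ hm]
  have : ∀ s, ENNReal.ofReal |f s| ≤ ENNReal.ofReal a +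
      ({s | a < |f s|}).indicator (fun s => ENNReal.ofReal |f s|) s := by
    intro s
    by_cases h : a < |f s|
    · rw [indicator_of_mem (by exact h)]; exact le_add_self
    · rw [indicator_of_notMem (by exact h), add_zero]
      exact ENNReal.ofReal_le_ofReal (not_lt.1 h)
  refine (lintegral_mono this).trans ?_
  rw [lintegral_add_left measurable_const, lintegral_const, Measure.restrict_apply_univ,
    ENNReal.ofReal_mul (by positivity), mul_comm]
  refine add_le_add (mul_le_mul_left (sg_Icc_le t r) _) ?_
  rw [← lintegral_indicator hm]
  exact setLIntegral_le_lintegral _ _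

lemma weak_est (f : ℝ → ℝ) (hf : Measurable f) (l : ℝ) (hl : 0 < l) :
    (volume.restrict (Ioi 0)) {r : ℝ | ENNReal.ofReal l < (ENNReal.ofReal r)⁻¹ * GG f r} ≤
      ENNReal.ofReal (2 / l) *
        (sg.withDensity (fun s => ENNReal.ofReal |f s|)) {s | l < 4 * |f s|} := by
  set ν := (sg.withDensity (fun s => ENNReal.ofReal |f s|)) {s | l < 4 * |f s|} with hν
  have hset : {s | l / 4 < |f s|} = {s | l < 4 * |f s|} := by
    ext s; simp only [mem_ofPred_eq]
    constructor <;> intro <;> linarith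
  by_cases htop : ν = ∞
  · rw [htop, ENNReal.mul_top]
    · exact le_top
    · simp; positivity
  have hsub : {r : ℝ | ENNReal.ofReal l < (ENNReal.ofReal r)⁻¹ * GG f r} ∩ Ioi 0 ⊆
      Ioo 0 (2 / l * ν.toReal) := by
    rintro r ⟨h1, h2⟩
    simp only [mem_Ioi, mem_ofPred_eq] at h1 h2
    refine ⟨h2, ?_⟩
    have h3 := GG_le_split f hf (l/4) r (by positivity) h2
    rw [hset, ← hν, ← ENNReal.ofReal_toReal htop, ← ENNReal.ofReal_add (by positivity) (by positivity)] at h3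
    have h4 := h1.trans_le (mul_le_mul_right h3 _)
    rw [← ENNReal.ofReal_inv_of_pos h2, ← ENNReal.ofReal_mul (by positivity)] at h4
    have h5 := (ENNReal.ofReal_lt_ofReal_iff_of_nonneg hl.le).1 h4
    rw [inv_mul_eq_div, lt_div_iff₀ h2] at h5
    rw [div_mul_eq_mul_div, lt_div_iff₀ hl]
    linarith
  rw [Measure.restrict_apply₀']
  · refine (measure_mono hsub).trans ?_
    rw [Real.volume_Ioo, sub_zero, ENNReal.ofReal_mul (by positivity), ENNReal.ofReal_toReal htop]
  · exact measurableSet_Ioi.nullMeasurableSet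

lemma HH_meas (f : ℝ → ℝ) : Measurable (fun r => (ENNReal.ofReal r)⁻¹ * GG f r) :=
  (ENNReal.measurable_ofReal.inv).mul (GG_mono f).measurable

lemma strong_p (f : ℝ → ℝ) (hf : Measurable f) (p : ℝ) (hp : 1 < p)
    (hfin : ∫⁻ s, ENNReal.ofReal |f s| ∂sg ≠ ∞) :
    ∫⁻ r in Ioi (0 : ℝ), ((ENNReal.ofReal r)⁻¹ * GG f r) ^ p ≤
      ENNReal.ofReal (2 * p / (p - 1) * 4 ^ (p - 1)) * ∫⁻ s, ENNReal.ofReal |f s| ^ p ∂sg := by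
  have hG : ∀ r, GG f r ≠ ∞ := fun r => ne_top_of_le_ne_top hfin (GG_le_one f r)
  set H : ℝ → ℝ≥0∞ := fun r => (ENNReal.ofReal r)⁻¹ * GG f r with hH
  have hHfin : ∀ r ∈ Ioi (0:ℝ), H r ≠ ∞ := fun r hr =>
    ENNReal.mul_ne_top (by simpa using hr) (hG r)
  have e1 : ∫⁻ r in Ioi (0 : ℝ), H r ^ p =
      ∫⁻ r in Ioi (0 : ℝ), ENNReal.ofReal ((H r).toReal ^ p) := by
    refine setLIntegral_congr_fun measurableSet_Ioi fun r hr => ?_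
    change H r ^ p = ENNReal.ofReal ((H r).toReal ^ p)
    rw [← ENNReal.ofReal_rpow_of_nonneg (by positivity) (by linarith), ENNReal.ofReal_toReal (hHfin r hr)]
  have e2 := lintegral_rpow_eq_lintegral_meas_lt_mul (volume.restrict (Ioi (0:ℝ)))
    (f := fun r => (H r).toReal) (ae_of_all _ fun _ => ENNReal.toReal_nonneg)
    (HH_meas f).ennreal_toReal.aemeasurable (p := p) (by linarith)
  have e3 := lintegral_rpow_eq_lintegral_meas_lt_mul (sg.withDensity (fun s => ENNReal.ofReal |f s|))
    (f := fun s => 4 * |f s|) (ae_of_all _ fun _ => by positivity)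
    (by fun_prop) (p := p - 1) (by linarith)
  have e4 : ∫⁻ s, ENNReal.ofReal ((4 * |f s|) ^ (p-1)) ∂(sg.withDensity (fun s => ENNReal.ofReal |f s|))
      = ENNReal.ofReal (4 ^ (p-1)) * ∫⁻ s, ENNReal.ofReal |f s| ^ p ∂sg := by
    rw [lintegral_withDensity_eq_lintegral_mul _ (by fun_prop) (by fun_prop),
      ← lintegral_const_mul' _ _ (by finiteness)]
    refine lintegral_congr fun s => ?_
    simp only [Pi.mul_apply]
    rw [ENNReal.ofReal_rpow_of_nonneg (by positivity) (by linarith),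
      ← ENNReal.ofReal_mul (by positivity), ← ENNReal.ofReal_mul (by positivity),
      Real.mul_rpow (by positivity) (by positivity)]
    congr 1
    have : |f s| ^ p = |f s| ^ (p - 1) * |f s| := by
      conv_rhs => rw [← Real.rpow_one |f s|, ← Real.rpow_mul (by positivity), one_mul]
      rw [← Real.rpow_add' (by positivity) (by linarith)]
      congr 1; ring
    rw [this]; ring
  have e5 : ∫⁻ t in Ioi (0:ℝ), (volume.restrict (Ioi (0:ℝ))) {a | t < (H a).toReal} * ENNReal.ofReal (t ^ (p - 1))
     ≤ ENNReal.ofReal 2 * ∫⁻ t in Ioi (0:ℝ), (sg.withDensity (fun s => ENNReal.ofReal |f s|)) {a | t < 4 * |f a|} * ENNReal.ofReal (t ^ (p - 1 - 1)) := by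
    rw [← lintegral_const_mul' _ _ (by finiteness)]
    refine setLIntegral_mono' measurableSet_Ioi fun t ht => ?_
    simp only [mem_Ioi] at ht
    have h1 : (volume.restrict (Ioi (0:ℝ))) {a | t < (H a).toReal} ≤
        (volume.restrict (Ioi (0:ℝ))) {a | ENNReal.ofReal t < H a} := by
      refine measure_mono fun a ha => ?_
      simp only [mem_ofPred_eq] at ha ⊢
      have hne : H a ≠ ∞ := by
        intro h
        rw [h, ENNReal.toReal_top] at ha
        linarith
      exact (ENNReal.ofReal_lt_iff_lt_toReal ht.le hne).2 ha
    refine (mul_le_mul_left (h1.trans (weak_est f hf t ht)) _).trans (le_of_eq ?_)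
    have : ENNReal.ofReal (2 / t) * ENNReal.ofReal (t ^ (p-1)) = ENNReal.ofReal 2 * ENNReal.ofReal (t ^ (p-1-1)) := by
      rw [← ENNReal.ofReal_mul (by positivity), ← ENNReal.ofReal_mul (by positivity), Real.rpow_sub_one ht.ne' (p-1)]
      congr 1; ring
    rw [mul_right_comm, this]; ring
  rw [e1, e2]
  rw [e4] at e3
  have hp1 : ENNReal.ofReal (p - 1) ≠ 0 := by simp; linarith
  calc _ ≤ _ := mul_le_mul_right e5 _
    _ = ENNReal.ofReal (2 * p / (p-1)) * (ENNReal.ofReal (p - 1) * ∫⁻ t in Ioi (0:ℝ), (sg.withDensity (fun s => ENNReal.ofReal |f s|)) {a | t < 4 * |f a|} * ENNReal.ofReal (t ^ (p - 1 - 1))) := by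
        rw [← mul_assoc, ← mul_assoc, ← ENNReal.ofReal_mul (by linarith), ← ENNReal.ofReal_mul (by apply div_nonneg <;> linarith)]
        congr 2
        have : p - 1 ≠ 0 := by linarith
        field_simp
    _ ≤ _ := by
        rw [← e3, ← mul_assoc, ← ENNReal.ofReal_mul (by apply div_nonneg <;> linarith)]

lemma mud_lintegral_le (d : ℕ) (g : ℝ → ℝ≥0∞) :
    ∫⁻ r, g r ∂(mud d) ≤ ∫⁻ r in Ioi (0:ℝ), ENNReal.ofReal (r ^ (d-1)) * g r :=
  lintegral_withDensity_le_lintegral_mul _ (by fun_prop) g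

lemma mud_Iic (d : ℕ) : mud d (Iic 0) = 0 := by
  refine (withDensity_absolutelyContinuous _ _) ?_
  rw [Measure.restrict_apply measurableSet_Iic]
  have : Iic (0:ℝ) ∩ Ioi 0 = ∅ := by
    ext x
    simp only [mem_inter_iff, mem_Iic, mem_Ioi, mem_empty_iff_false, iff_false]
    rintro ⟨h1, h2⟩
    linarith
  rw [this, measure_empty]

lemma mud_Ioo_le (d : ℕ) (hd : 1 < d) (b : ℝ) (hb : 0 ≤ b) :
    mud d (Ioo 0 b) ≤ ENNReal.ofReal b ^ d := by
  rw [mud, withDensity_apply _ measurableSet_Ioo, Measure.restrict_restrict measurableSet_Ioo]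
  refine (lintegral_mono_set inter_subset_left).trans ?_
  have : ∀ r ∈ Ioo 0 b, ENNReal.ofReal (r ^ (d-1)) ≤ ENNReal.ofReal b ^ (d-1) := by
    rintro r ⟨h1, h2⟩
    rw [← ENNReal.ofReal_pow hb]
    exact ENNReal.ofReal_le_ofReal (pow_le_pow_left₀ h1.le h2.le _)
  refine (setLIntegral_mono' measurableSet_Ioo this).trans ?_
  rw [lintegral_const, Measure.restrict_apply_univ, Real.volume_Ioo, sub_zero, ← pow_succ]
  apply le_of_eq
  congr 1
  omega

lemma R2_le_one (f : ℝ → ℝ) (r : ℝ) :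
    R2 f r ≤ (ENNReal.ofReal r)⁻¹ * ∫⁻ s, ENNReal.ofReal |f s| ∂sg :=
  (R2_le f r).trans (mul_le_mul_right (GG_le_one f r) _)

lemma part1 (d : ℕ) (hd : 1 < d) (f : ℝ → ℝ) :
    ∫⁻ r, R2 f r ∂(mud d) ≤ ENNReal.ofReal (2 ^ d * 2) * ∫⁻ s, ENNReal.ofReal |f s| ∂sg := by
  set N := ∫⁻ s, ENNReal.ofReal |f s| ∂sg
  refine (mud_lintegral_le d _).trans ?_
  have h : ∀ r ∈ Ioi (0:ℝ), ENNReal.ofReal (r ^ (d-1)) * R2 f r ≤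
      (Ioo (0:ℝ) 2).indicator (fun _ => ENNReal.ofReal (2 ^ d) * N) r := by
    intro r hr
    simp only [mem_Ioi] at hr
    rcases le_or_gt (4/3) r with h | h
    · rw [R2_zero f r h]; simp
    · have hmem : r ∈ Ioo (0:ℝ) 2 := ⟨hr, by linarith⟩
      rw [indicator_of_mem hmem]
      refine (mul_le_mul_right (R2_le_one f r) _).trans ?_
      rw [← mul_assoc]
      refine mul_le_mul_left ?_ _
      rw [← ENNReal.ofReal_inv_of_pos hr, ← ENNReal.ofReal_mul (by positivity)]
      apply ENNReal.ofReal_le_ofReal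
      obtain ⟨k, rfl⟩ : ∃ k, d = k + 2 := ⟨d - 2, by omega⟩
      have : r ^ (k + 2 - 1) * r⁻¹ = r ^ k := by
        rw [show k + 2 - 1 = k + 1 by omega, pow_succ]; field_simp
      rw [this]
      calc r ^ k ≤ 2 ^ k := pow_le_pow_left₀ hr.le (by linarith) _
        _ ≤ 2 ^ (k+2) := pow_le_pow_right₀ (by norm_num) (by omega)
  refine (setLIntegral_mono' measurableSet_Ioi h).trans ?_
  refine (setLIntegral_le_lintegral _ _).trans ?_
  rw [lintegral_indicator measurableSet_Ioo, lintegral_const, Measure.restrict_apply_univ,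
    Real.volume_Ioo, ENNReal.ofReal_mul (by positivity), sub_zero]
  apply le_of_eq; ring

lemma part2 (d : ℕ) (hd : 1 < d) (f : ℝ → ℝ) (l : ℝ≥0∞) (hl : 0 < l) :
    l * (mud d {r | l < R2 f r}) ^ (1 / (d : ℝ)) ≤ ∫⁻ s, ENNReal.ofReal |f s| ∂sg := by
  set N := ∫⁻ s, ENNReal.ofReal |f s| ∂sg with hN
  have hd0 : 0 < 1 / (d : ℝ) := by
    have : (0:ℝ) < d := by exact_mod_cast (by omega : 0 < d)
    positivity
  by_cases hNt : N = ∞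
  · rw [hNt]; exact le_top
  by_cases hlt : l = ∞
  · have : {r | l < R2 f r} = ∅ := by ext r; simp [hlt]
    rw [this, measure_empty, ENNReal.zero_rpow_of_pos hd0, mul_zero]; exact zero_le
  have hb : N / l ≠ ∞ := ENNReal.div_ne_top hNt hl.ne'
  have hsub : {r | l < R2 f r} ⊆ Iic 0 ∪ Ioo 0 (N / l).toReal := by
    intro r hr
    rcases le_or_gt r 0 with h | h
    · exact Or.inl h
    · refine Or.inr ⟨h, ?_⟩
      have h2 : l < (ENNReal.ofReal r)⁻¹ * N := lt_of_lt_of_le hr (R2_le_one f r)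
      rw [← ENNReal.ofReal_lt_iff_lt_toReal h.le hb]
      rw [mul_comm, ← div_eq_mul_inv, ENNReal.lt_div_iff_mul_lt (by simp [h]) (by simp)] at h2
      rw [ENNReal.lt_div_iff_mul_lt (by simp [hl.ne']) (by simp [hlt]), mul_comm]
      exact h2
  have hm : mud d {r | l < R2 f r} ≤ (N / l) ^ d := by
    refine (measure_mono hsub).trans ((measure_union_le _ _).trans ?_)
    rw [mud_Iic, zero_add]
    refine (mud_Ioo_le d hd _ ENNReal.toReal_nonneg).trans ?_
    rw [ENNReal.ofReal_toReal hb]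
  calc _ ≤ l * ((N / l) ^ d) ^ (1 / (d:ℝ)) := by gcongr
    _ = l * (N / l) := by
        rw [← ENNReal.rpow_natCast, ← ENNReal.rpow_mul, mul_one_div_cancel, ENNReal.rpow_one]
        exact_mod_cast (by omega : d ≠ 0)
    _ ≤ N := ENNReal.mul_div_le

lemma real_est (d : ℕ) (hd : 1 < d) (p q r : ℝ) (hp : 1 < p) (hpq : p ≤ q) (hq : q ≤ p * d)
    (hr : 0 < r) (hr2 : r ≤ 2) :
    r ^ (d-1) * (r⁻¹ * (2 * r) ^ (1 - 1/p)) ^ (q - p) ≤ 2 ^ (q - p) * 2 ^ d := by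
  have hp0 : 0 < p := by linarith
  have h1 : r⁻¹ * (2 * r) ^ (1 - 1/p) ≤ 2 * r ^ (-(1/p)) := by
    rw [Real.mul_rpow (by norm_num) hr.le, sub_eq_add_neg, Real.rpow_add hr, Real.rpow_one]
    have : (2:ℝ) ^ (1 + -(1/p)) ≤ 2 := by
      conv_rhs => rw [← Real.rpow_one 2]
      apply Real.rpow_le_rpow_of_exponent_le (by norm_num)
      have : 0 < 1/p := by positivity
      linarith
    calc _ = (2:ℝ) ^ (1 + -(1/p)) * r ^ (-(1/p)) := by field_simp
      _ ≤ _ := by gcongr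
  have h2 : (r⁻¹ * (2 * r) ^ (1 - 1/p)) ^ (q - p) ≤ 2 ^ (q-p) * r ^ (-(1/p) * (q - p)) := by
    rw [Real.rpow_mul hr.le, ← Real.mul_rpow (by norm_num) (by positivity)]
    exact Real.rpow_le_rpow (by positivity) h1 (by linarith)
  have h3 : r ^ (d - 1) * r ^ (-(1/p) * (q - p)) ≤ 2 ^ d := by
    rw [← Real.rpow_natCast, ← Real.rpow_add hr]
    have hc : ((d - 1 : ℕ) : ℝ) = d - 1 := by
      rw [Nat.cast_sub (by omega)]; simp
    have e : ((d - 1 : ℕ) : ℝ) + -(1/p) * (q - p) = d - q / p := by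
      rw [hc]; field_simp; ring
    have e1 : q / p ≤ d := by rw [div_le_iff₀ hp0]; linarith
    have e2 : 0 ≤ q / p := by apply div_nonneg <;> linarith
    rw [e]
    calc r ^ ((d:ℝ) - q/p) ≤ 2 ^ ((d:ℝ) - q/p) := Real.rpow_le_rpow hr.le hr2 (by linarith)
      _ ≤ 2 ^ (d:ℝ) := Real.rpow_le_rpow_of_exponent_le (by norm_num) (by linarith)
      _ = 2 ^ d := Real.rpow_natCast _ _
  calc _ ≤ r ^ (d-1) * (2 ^ (q-p) * r ^ (-(1/p) * (q - p))) := by gcongr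
    _ = 2 ^ (q-p) * (r ^ (d-1) * r ^ (-(1/p) * (q - p))) := by ring
    _ ≤ _ := by gcongr

lemma part3 (d : ℕ) (hd : 1 < d) (p q : ℝ) (hp : 1 < p) (hpq : p ≤ q) (hq : q ≤ p * d)
    (f : ℝ → ℝ) (hf : Measurable f) :
    ∫⁻ r, R2 f r ^ q ∂(mud d) ≤
      ENNReal.ofReal (2 ^ (q - p) * 2 ^ d) * ENNReal.ofReal (2 * p / (p - 1) * 4 ^ (p - 1)) *
        (∫⁻ s, ENNReal.ofReal |f s| ^ p ∂sg) ^ (q / p) := by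
  set I := ∫⁻ s, ENNReal.ofReal |f s| ^ p ∂sg with hI
  have hp0 : 0 < p := by linarith
  have hp1 : 0 < p - 1 := by linarith
  by_cases hIt : I = ∞
  · rw [hIt, ENNReal.top_rpow_of_pos (div_pos (by linarith) hp0), ENNReal.mul_top]
    · exact le_top
    · rw [← ENNReal.ofReal_mul (by positivity)]
      exact (ENNReal.ofReal_pos.2 (by positivity)).ne'
  have hfin : ∫⁻ s, ENNReal.ofReal |f s| ∂sg ≠ ∞ := by
    refine ne_top_of_le_ne_top (b := sg univ + I) ?_ ?_
    · refine ENNReal.add_ne_top.2 ⟨?_, hIt⟩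
      rw [sg, Measure.restrict_apply_univ, Real.volume_Icc]; finiteness
    · rw [hI, ← lintegral_one, ← lintegral_add_left measurable_const]
      refine lintegral_mono fun s => ?_
      rcases le_total (ENNReal.ofReal |f s|) 1 with h | h
      · exact h.trans le_self_add
      · refine le_trans ?_ le_add_self
        conv_lhs => rw [← ENNReal.rpow_one (ENNReal.ofReal |f s|)]
        exact ENNReal.rpow_le_rpow_of_exponent_le h hp.le
  refine (mud_lintegral_le d _).trans ?_
  have h : ∀ r ∈ Ioi (0:ℝ), ENNReal.ofReal (r ^ (d-1)) * R2 f r ^ q ≤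
      (ENNReal.ofReal (2 ^ (q - p) * 2 ^ d) * I ^ ((q-p)/p)) *
        ((ENNReal.ofReal r)⁻¹ * GG f r) ^ p := by
    intro r hr
    simp only [mem_Ioi] at hr
    rcases le_or_gt (4/3) r with h | h
    · rw [R2_zero f r h, ENNReal.zero_rpow_of_pos (by linarith)]; simp
    · have e1 : R2 f r ^ q = R2 f r ^ (q - p) * R2 f r ^ p := by
        rw [← ENNReal.rpow_add_of_nonneg _ _ (by linarith) hp0.le]; congr 1; ring
      have e2 : R2 f r ≤ ENNReal.ofReal (r⁻¹ * (2 * r) ^ (1 - 1/p)) * I ^ (1/p) := by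
        refine (R2_le f r).trans ((mul_le_mul_right (GG_le_p f hf p hp r) _).trans ?_)
        have : 0 ≤ 1 - 1/p := by
          have : 1/p ≤ 1 := by rw [div_le_one hp0]; linarith
          linarith
        rw [ENNReal.ofReal_mul (p := r⁻¹) (by positivity), ENNReal.ofReal_inv_of_pos hr,
          ENNReal.ofReal_rpow_of_nonneg (by positivity) this, mul_assoc]
      have e3 : R2 f r ^ (q - p) ≤
          ENNReal.ofReal ((r⁻¹ * (2 * r) ^ (1 - 1/p)) ^ (q - p)) * I ^ ((q-p)/p) := by
        refine (ENNReal.rpow_le_rpow e2 (by linarith)).trans ?_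
        rw [ENNReal.mul_rpow_of_nonneg _ _ (by linarith),
          ENNReal.ofReal_rpow_of_nonneg (by positivity) (by linarith), ← ENNReal.rpow_mul,
          one_div_mul_eq_div]
      rw [e1, ← mul_assoc]
      refine mul_le_mul' ?_ (ENNReal.rpow_le_rpow (R2_le f r) hp0.le)
      refine (mul_le_mul_right e3 _).trans ?_
      rw [← mul_assoc, ← ENNReal.ofReal_mul (by positivity)]
      refine mul_le_mul_left (ENNReal.ofReal_le_ofReal ?_) _
      exact real_est d hd p q r hp hpq hq hr (by linarith)
  refine (setLIntegral_mono' measurableSet_Ioi h).trans ?_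
  have hIp : I ^ ((q-p)/p) ≠ ∞ := ENNReal.rpow_ne_top_of_nonneg (div_nonneg (by linarith) hp0.le) hIt
  rw [lintegral_const_mul' _ _ (ENNReal.mul_ne_top (by finiteness) hIp)]
  refine (mul_le_mul_right (strong_p f hf p hp hfin) _).trans (le_of_eq ?_)
  have : I ^ (q / p) = I ^ ((q-p)/p) * I := by
    conv_rhs => rw [← ENNReal.rpow_one I, ← ENNReal.rpow_mul, one_mul]
    rw [← ENNReal.rpow_add_of_nonneg _ _ (div_nonneg (by linarith) hp0.le) (by norm_num)]
    congr 1; field_simp; ring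
  rw [this]; ring

theorem R2_bounds (d : ℕ) (hd : 1 < d) :
    (∃ C : ℝ≥0, ∀ f : ℝ → ℝ, Measurable f →
      lpNormE (mud d) 1 (R2 f) ≤ C * lpNormE (mud d) 1 (fun s => ENNReal.ofReal |f s|)) ∧
    (∃ C : ℝ≥0, ∀ f : ℝ → ℝ, Measurable f → ∀ l : ℝ≥0∞, 0 < l →
      l * (mud d {r | l < R2 f r}) ^ (1 / (d : ℝ)) ≤
        C * lpNormE (mud d) 1 (fun s => ENNReal.ofReal |f s|)) ∧
    (∀ p q : ℝ≥0∞, 1 < p → p ≤ q → q ≤ p * d →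
      ∃ C : ℝ≥0, ∀ f : ℝ → ℝ, Measurable f →
        lpNormE (mud d) q (R2 f) ≤ C * lpNormE (mud d) p (fun s => ENNReal.ofReal |f s|)) := by
  have l1 : ∀ (g : ℝ → ℝ≥0∞), lpNormE (mud d) 1 g = ∫⁻ r, g r ∂(mud d) := by
    intro g; simp [lpNormE]
  refine ⟨⟨(2 ^ d * 2) * 3 ^ (d-1), fun f hf => ?_⟩, ⟨3 ^ (d-1), fun f hf l hl => ?_⟩, ?_⟩
  · rw [l1, l1]
    refine (part1 d hd f).trans ((mul_le_mul_right (sg_lintegral_le d _) _).trans (le_of_eq ?_))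
    rw [← mul_assoc]
    congr 1
    rw [ENNReal.ofReal_mul (by positivity), ENNReal.ofReal_pow (by norm_num)]
    simp
  · rw [l1]
    refine (part2 d hd f l hl).trans ((sg_lintegral_le d _).trans (le_of_eq ?_))
    simp
  · intro p q hp hpq hq
    by_cases hpt : p = ∞
    · have hqt : q = ∞ := top_le_iff.1 (hpt ▸ hpq)
      refine ⟨2, fun f hf => ?_⟩
      simp only [lpNormE, hpt, hqt, if_true]
      refine essSup_le_of_ae_le _ ?_
      have h0 : ∀ᵐ r ∂(mud d), 0 < r := by
        have := mud_Iic d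
        rw [ae_iff]
        convert this using 2
        ext r; simp
      filter_upwards [h0] with r hr
      refine (R2_le f r).trans ((mul_le_mul_right (GG_le_top f d r) _).trans (le_of_eq ?_))
      rw [← mul_assoc]
      congr 1
      rw [← ENNReal.ofReal_inv_of_pos hr, ← ENNReal.ofReal_mul (by positivity),
        show r⁻¹ * (2 * r) = 2 by field_simp]
      simp
    · have hqt : q ≠ ∞ := ne_top_of_le_ne_top (ENNReal.mul_ne_top hpt (by simp)) hq
      have hp' : 1 < p.toReal := by
        rw [← ENNReal.toReal_one]
        exact (ENNReal.toReal_lt_toReal (by simp) hpt).2 hp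
      have hpq' : p.toReal ≤ q.toReal := ENNReal.toReal_mono hqt hpq
      have hq' : q.toReal ≤ p.toReal * d := by
        have := ENNReal.toReal_mono (ENNReal.mul_ne_top hpt (by simp)) hq
        simpa using this
      set P := p.toReal
      set Q := q.toReal
      have hP0 : 0 < P := by linarith
      have hQ0 : 0 < Q := by linarith
      set K : ℝ≥0∞ := ENNReal.ofReal (2 ^ (Q - P) * 2 ^ d) *
        ENNReal.ofReal (2 * P / (P - 1) * 4 ^ (P - 1)) with hK
      have hKt : K ≠ ∞ := by rw [hK]; finiteness
      have hCt : K ^ (1 / Q) * ((3:ℝ≥0∞) ^ (d-1)) ^ (1 / P) ≠ ∞ :=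
        ENNReal.mul_ne_top (ENNReal.rpow_ne_top_of_nonneg (by positivity) hKt)
          (ENNReal.rpow_ne_top_of_nonneg (by positivity) (by finiteness))
      refine ⟨(K ^ (1 / Q) * ((3:ℝ≥0∞) ^ (d-1)) ^ (1 / P)).toNNReal, fun f hf => ?_⟩
      rw [ENNReal.coe_toNNReal hCt]
      simp only [lpNormE, hpt, hqt, if_false]
      refine (ENNReal.rpow_le_rpow (part3 d hd P Q hp' hpq' hq' f hf) (by positivity)).trans ?_
      rw [← hK, ENNReal.mul_rpow_of_nonneg _ _ (by positivity), ← ENNReal.rpow_mul, mul_assoc,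
        show Q / P * (1 / Q) = 1 / P by field_simp]
      refine mul_le_mul_right ?_ _
      rw [← ENNReal.mul_rpow_of_nonneg _ _ (by positivity)]
      exact ENNReal.rpow_le_rpow (sg_lintegral_le d _) (by positivity)
end
end

section
/- Stein's radial counterexample: for d ≥ 2 and p_d = d/(d−1), the function F(x) = |x|^{−(d−1)}·(log(1/|x|))^{−1}·χ_{(0,1/2]}(|x|) on ℝ^d belongs to the Lorentz space L^{p_d, r}(ℝ^d) for every r > 1, but the spherical maximal function over [1,2] satisfies M_{[1,2]}F(x) = ∞ whenever |x| ∈ [1,2]. -/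
open Set MeasureTheory Metric
open scoped ENNReal NNReal

noncomputable section

variable {d : ℕ}

/-- The normalized surface measure on the unit sphere of `ℝ^d`. -/
def sphMeasure (d : ℕ) : Measure (sphere (0 : EuclideanSpace ℝ (Fin d)) 1) :=
  (((volume : Measure (EuclideanSpace ℝ (Fin d))).toSphere univ)⁻¹) •
    (volume : Measure (EuclideanSpace ℝ (Fin d))).toSphere

/-- Spherical average (of the absolute value) at radius `t`:
`A_t f(x) = ∫_{𝕊^{d-1}} |f(x − ty)| dσ(y)` with `σ` normalized. -/
def sphAvg (d : ℕ) (f : EuclideanSpace ℝ (Fin d) → ℝ) (t : ℝ)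
    (x : EuclideanSpace ℝ (Fin d)) : ℝ≥0∞ :=
  ∫⁻ y : sphere (0 : EuclideanSpace ℝ (Fin d)) 1,
    ENNReal.ofReal |f (x - t • (y : EuclideanSpace ℝ (Fin d)))| ∂(sphMeasure d)

/-- Spherical maximal operator over the dilation set `T`. -/
def sphMax (d : ℕ) (T : Set ℝ) (f : EuclideanSpace ℝ (Fin d) → ℝ)
    (x : EuclideanSpace ℝ (Fin d)) : ℝ≥0∞ :=
  ⨆ t ∈ T, sphAvg d f t x

/-- The Lorentz `L^{p,r}` quasinorm (for finite `r`):
`‖g‖_{p,r} = (∫_0^∞ λ^{r-1} μ({g > λ})^{r/p} dλ)^{1/r}`. -/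
def lorentzNorm {α : Type*} [MeasurableSpace α] (μ : Measure α) (p r : ℝ)
    (g : α → ℝ≥0∞) : ℝ≥0∞ :=
  (∫⁻ l in Ioi (0 : ℝ),
    ENNReal.ofReal (l ^ (r - 1)) * (μ {x | ENNReal.ofReal l < g x}) ^ (r / p)) ^ (1 / r)

/-- Stein's radial counterexample `F(x) = |x|^{−(d−1)} (log(1/|x|))^{−1} χ_{(0,1/2]}(|x|)`. -/
def steinF (d : ℕ) (x : EuclideanSpace ℝ (Fin d)) : ℝ :=
  if 0 < ‖x‖ ∧ ‖x‖ ≤ 1 / 2 then ‖x‖ ^ (-(d - 1 : ℝ)) * (Real.log (1 / ‖x‖))⁻¹ else 0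

open Filter Topology Pointwise

lemma steinF_eq (n : ℕ) (x : EuclideanSpace ℝ (Fin (n + 1))) (h0 : 0 < ‖x‖) (h1 : ‖x‖ ≤ 1 / 2) :
    steinF (n + 1) x = (‖x‖ ^ n)⁻¹ * (Real.log (1 / ‖x‖))⁻¹ := by
  have : (-(((n + 1 : ℕ) : ℝ) - 1)) = -(n : ℝ) := by push_cast; ring
  rw [steinF, if_pos ⟨h0, h1⟩, this, Real.rpow_neg h0.le, Real.rpow_natCast]

lemma steinF_zero (d : ℕ) (x : EuclideanSpace ℝ (Fin d)) (h : ¬ (0 < ‖x‖ ∧ ‖x‖ ≤ 1 / 2)) :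
    steinF d x = 0 := if_neg h

lemma log_inv_pos {s : ℝ} (h0 : 0 < s) (h1 : s ≤ 1 / 2) : Real.log 2 ≤ Real.log (1 / s) := by
  apply Real.log_le_log (by norm_num)
  rw [le_div_iff₀ h0]; linarith

lemma steinF_nonneg (n : ℕ) (x : EuclideanSpace ℝ (Fin (n + 1))) : 0 ≤ steinF (n + 1) x := by
  by_cases h : 0 < ‖x‖ ∧ ‖x‖ ≤ 1 / 2
  · rw [steinF_eq n x h.1 h.2]
    have h2 := log_inv_pos h.1 h.2
    have h3 : 0 < Real.log 2 := Real.log_pos (by norm_num)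
    have h4 : 0 < Real.log (1 / ‖x‖) := by linarith
    positivity
  · rw [steinF_zero _ x h]

lemma steinF_measurable (d : ℕ) : Measurable (steinF d) := by
  unfold steinF
  apply Measurable.ite
  · apply MeasurableSet.inter
    · exact measurableSet_lt measurable_const measurable_norm
    · exact measurableSet_le measurable_norm measurable_const
  · fun_prop
  · fun_prop

/-- elementary: `u > 2 l log l` implies `u > l log u`. -/
lemma lt_aux {u l : ℝ} (hl : Real.exp 1 ≤ l) (hu : 2 * l * Real.log l < u) :
    l * Real.log u < u := by
  have hl0 : 0 < l := (Real.exp_pos 1).trans_le hl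
  have hll : 1 ≤ Real.log l := by rwa [Real.le_log_iff_exp_le hl0]
  have hu0 : 0 < u := lt_of_le_of_lt (by positivity) hu
  by_cases h : u < l ^ 2
  · have h1 : Real.log u ≤ 2 * Real.log l := by
      have := Real.log_le_log hu0 h.le
      rwa [Real.log_pow] at this
    nlinarith
  · push Not at h
    have hs : l ≤ √u := Real.le_sqrt_of_sq_le h
    have hs0 : 0 < √u := by positivity
    have h2 : Real.log u = 2 * Real.log (√u) := by
      rw [Real.log_sqrt hu0.le]; ring
    have h3 : Real.log (√u / 2) ≤ √u / 2 - 1 := Real.log_le_sub_one_of_pos (by positivity)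
    rw [Real.log_div hs0.ne' (by norm_num)] at h3
    have h4 : Real.log 2 < 1 := by have := Real.log_two_lt_d9; linarith
    have h5 : Real.log u < √u := by rw [h2]; linarith
    calc l * Real.log u < l * √u := by gcongr
      _ ≤ √u * √u := by gcongr
      _ = u := Real.mul_self_sqrt hu0.le

lemma steinF_lower (n : ℕ) (hn : 1 ≤ n) (x : EuclideanSpace ℝ (Fin (n + 1))) (h0 : 0 < ‖x‖)
    (h1 : ‖x‖ ≤ 1 / 2) {l : ℝ} (hl : Real.exp 1 ≤ l)
    (hx : ‖x‖ ^ n * (2 * l * Real.log l) < 1) : l < steinF (n + 1) x := by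
  rw [steinF_eq n x h0 h1]
  have h2 := log_inv_pos h0 h1
  have h3 : 0 < Real.log 2 := Real.log_pos (by norm_num)
  have h4 : 0 < Real.log (1 / ‖x‖) := by linarith
  have hl0 : 0 < l := (Real.exp_pos 1).trans_le hl
  have key := lt_aux (u := (‖x‖ ^ n)⁻¹) hl (by
    rw [lt_inv_comm₀, ] <;> first | positivity | skip
    · rw [← one_div, lt_div_iff₀]; exact hx
      have : 1 ≤ Real.log l := by rwa [Real.le_log_iff_exp_le hl0]
      positivity
    · have : 1 ≤ Real.log l := by rwa [Real.le_log_iff_exp_le hl0]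
      positivity)
  rw [← div_eq_mul_inv, lt_div_iff₀ h4]
  refine lt_of_le_of_lt ?_ key
  refine mul_le_mul_of_nonneg_left ?_ hl0.le
  rw [← inv_pow, Real.log_pow, ← one_div]
  have : (1 : ℝ) ≤ n := by exact_mod_cast hn
  nlinarith

lemma steinF_upper (n : ℕ) (hn : 1 ≤ n) (x : EuclideanSpace ℝ (Fin (n + 1)))
    {l : ℝ} (hl1 : 1 < l) (hl : - 2 * Real.log (Real.log 2) ≤ Real.log l)
    (hx : l < steinF (n + 1) x) : ‖x‖ ^ n ≤ 2 * n / (l * Real.log l) := by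
  have hll : 0 < Real.log l := Real.log_pos hl1
  by_cases h : 0 < ‖x‖ ∧ ‖x‖ ≤ 1 / 2
  swap
  · rw [steinF_zero _ x h] at hx; linarith
  obtain ⟨h0, h1⟩ := h
  rw [steinF_eq n x h0 h1] at hx
  have h2 := log_inv_pos h0 h1
  have h3 : 0 < Real.log 2 := Real.log_pos (by norm_num)
  have h4 : 0 < Real.log (1 / ‖x‖) := by linarith
  rw [← div_eq_mul_inv, lt_div_iff₀ h4] at hx
  have h5 : l * Real.log 2 < (‖x‖ ^ n)⁻¹ := lt_of_le_of_lt (by gcongr) hx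
  have h6 := Real.log_lt_log (by positivity) h5
  rw [← inv_pow, Real.log_pow, ← one_div, Real.log_mul (by positivity) h3.ne'] at h6
  have hn' : (1 : ℝ) ≤ n := by exact_mod_cast hn
  have h7 : Real.log l ≤ 2 * n * Real.log (1 / ‖x‖) := by linarith
  have h8 : l * Real.log l ≤ 2 * n * (‖x‖ ^ n)⁻¹ := by
    calc l * Real.log l ≤ l * (2 * n * Real.log (1 / ‖x‖)) := by gcongr
      _ = 2 * n * (l * Real.log (1 / ‖x‖)) := by ring
      _ ≤ _ := by gcongr
  rw [le_div_iff₀ (by positivity)]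
  have h9 : 0 < ‖x‖ ^ n := by positivity
  calc ‖x‖ ^ n * (l * Real.log l) ≤ ‖x‖ ^ n * (2 * n * (‖x‖ ^ n)⁻¹) := by gcongr
    _ = 2 * n := by field_simp

/-- a small ball around `ρ e` lies in the cone over the cap. -/
lemma ball_subset_cone {E : Type*} [NormedAddCommGroup E] [NormedSpace ℝ E] (e : E) (he : ‖e‖ = 1)
    {δ ρ : ℝ} (hδ : 0 < δ) (hδ1 : δ ≤ 1 / 4) (hρ : 1 / 2 ≤ ρ) (hρ1 : ρ + δ / 4 ≤ 1) :
    ball (ρ • e) (δ / 4) ⊆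
      Ioo (0 : ℝ) 1 • ((↑) '' {y : sphere (0 : E) 1 | ‖e - (y : E)‖ < δ}) := by
  intro z hz
  rw [mem_ball, dist_eq_norm] at hz
  have hρ0 : 0 < ρ := by linarith
  have hn : ‖ρ • e‖ = ρ := by rw [norm_smul, he, mul_one, Real.norm_of_nonneg hρ0.le]
  have h1 : |‖z‖ - ρ| ≤ ‖z - ρ • e‖ := by
    have := abs_norm_sub_norm_le z (ρ • e); rwa [hn] at this
  have h2 := abs_le.1 h1
  have hz0 : 0 < ‖z‖ := by linarith
  have hz1 : ‖z‖ < 1 := by linarith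
  have hy : ‖‖z‖⁻¹ • z‖ = 1 := by
    rw [norm_smul, norm_inv, norm_norm, inv_mul_cancel₀ hz0.ne']
  refine Set.mem_smul.2 ⟨‖z‖, ⟨hz0, hz1⟩, ‖z‖⁻¹ • z, ⟨⟨‖z‖⁻¹ • z, by simpa using hy⟩, ?_, rfl⟩, ?_⟩
  · change ‖e - ‖z‖⁻¹ • z‖ < δ
    have h3 : ρ • (e - ‖z‖⁻¹ • z) = (ρ • e - z) + ((‖z‖ - ρ) * ‖z‖⁻¹) • z := by
      have : z = (‖z‖ * ‖z‖⁻¹) • z := by rw [mul_inv_cancel₀ hz0.ne', one_smul]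
      rw [sub_mul, sub_smul, ← this, smul_sub, smul_smul]; abel
    have h4 : ρ * ‖e - ‖z‖⁻¹ • z‖ ≤ 2 * ‖z - ρ • e‖ := by
      calc ρ * ‖e - ‖z‖⁻¹ • z‖ = ‖ρ • (e - ‖z‖⁻¹ • z)‖ := by
            rw [norm_smul, Real.norm_of_nonneg hρ0.le]
        _ ≤ ‖ρ • e - z‖ + ‖((‖z‖ - ρ) * ‖z‖⁻¹) • z‖ := by rw [h3]; exact norm_add_le _ _
        _ = ‖z - ρ • e‖ + |‖z‖ - ρ| := by
            rw [norm_sub_rev, mul_smul, norm_smul, hy, mul_one, Real.norm_eq_abs]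
        _ ≤ _ := by linarith
    have h5 : 0 ≤ ‖e - ‖z‖⁻¹ • z‖ := norm_nonneg _
    nlinarith
  · rw [smul_smul, mul_inv_cancel₀ hz0.ne', one_smul]

lemma cap_lower (n : ℕ) (e : EuclideanSpace ℝ (Fin (n + 1))) (he : ‖e‖ = 1)
    {δ : ℝ} (hδ : 0 < δ) (hδ1 : δ ≤ 1 / 4) :
    ENNReal.ofReal ((δ / 4) ^ n / 8) * volume (ball (0 : EuclideanSpace ℝ (Fin (n + 1))) 1) ≤
      (volume : Measure (EuclideanSpace ℝ (Fin (n + 1)))).toSphere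
        {y | ‖e - (y : EuclideanSpace ℝ (Fin (n + 1)))‖ < δ} := by
  have hm : MeasurableSet {y : sphere (0 : EuclideanSpace ℝ (Fin (n + 1))) 1 |
      ‖e - (y : EuclideanSpace ℝ (Fin (n + 1)))‖ < δ} :=
    measurableSet_lt (by fun_prop) measurable_const
  rw [Measure.toSphere_apply' _ hm]
  set η := δ / 4 with hη
  have hη0 : 0 < η := by positivity
  set N := ⌊1 / (4 * η)⌋₊ with hN
  have hN1 : (N : ℝ) ≤ 1 / (4 * η) := Nat.floor_le (by positivity)
  have hN2 : 1 / (4 * η) < N + 1 := Nat.lt_floor_add_one _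
  rw [le_div_iff₀ (by positivity)] at hN1
  rw [div_lt_iff₀ (by positivity)] at hN2
  have hsub : (⋃ k ∈ Finset.range N, ball ((1 / 2 + 2 * η * (k : ℝ)) • e) η) ⊆
      Ioo (0 : ℝ) 1 • ((↑) '' {y : sphere (0 : EuclideanSpace ℝ (Fin (n + 1))) 1 |
        ‖e - (y : EuclideanSpace ℝ (Fin (n + 1)))‖ < δ}) := by
    refine iUnion₂_subset fun k hk => ?_
    have hk' : (k : ℝ) + 1 ≤ N := by exact_mod_cast Finset.mem_range.1 hk
    have hk0 : (0 : ℝ) ≤ k := Nat.cast_nonneg k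
    apply ball_subset_cone e he hδ hδ1
    · have := mul_nonneg hη0.le hk0
      linarith
    · rw [← hη]; nlinarith
  have hdisj : (↑(Finset.range N) : Set ℕ).PairwiseDisjoint
      (fun k : ℕ => ball ((1 / 2 + 2 * η * (k : ℝ)) • e) η) := by
    intro j _ k _ hjk
    apply ball_disjoint_ball
    rw [dist_eq_norm, ← sub_smul, norm_smul, he, mul_one, Real.norm_eq_abs]
    have h1 : (1 : ℝ) ≤ |(j : ℝ) - k| := by
      have : (1 : ℤ) ≤ |(j : ℤ) - k| := Int.one_le_abs (by omega)
      exact_mod_cast this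
    have : (1 / 2 + 2 * η * (j : ℝ) - (1 / 2 + 2 * η * (k : ℝ))) = 2 * η * ((j : ℝ) - k) := by ring
    rw [this, abs_mul, abs_of_pos (by positivity)]
    nlinarith
  have hmeas := measure_mono (μ := (volume : Measure (EuclideanSpace ℝ (Fin (n + 1))))) hsub
  rw [measure_biUnion_finset hdisj (fun _ _ => measurableSet_ball)] at hmeas
  simp only [Measure.addHaar_ball_of_pos _ _ hη0, finrank_euclideanSpace, Fintype.card_fin,
    Finset.sum_const, Finset.card_range, nsmul_eq_mul] at hmeas
  have h1 : (1 : ℝ≥0∞) ≤ (Module.finrank ℝ (EuclideanSpace ℝ (Fin (n + 1))) : ℝ≥0∞) := by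
    rw [finrank_euclideanSpace, Fintype.card_fin]; exact_mod_cast Nat.le_add_left 1 n
  refine le_trans ?_ (le_trans hmeas (le_mul_of_one_le_left zero_le h1))
  rw [← mul_assoc]
  gcongr
  rw [← ENNReal.ofReal_natCast, ← ENNReal.ofReal_mul (Nat.cast_nonneg _)]
  apply ENNReal.ofReal_le_ofReal
  have h8 : 1 / 8 ≤ N * η := by nlinarith
  calc η ^ n / 8 = η ^ n * (1 / 8) := by ring
    _ ≤ η ^ n * (N * η) := by gcongr
    _ = _ := by ring

lemma point_null (n : ℕ) (hn : 1 ≤ n) (e : EuclideanSpace ℝ (Fin (n + 1))) :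
    (volume : Measure (EuclideanSpace ℝ (Fin (n + 1)))).toSphere
        {y | (y : EuclideanSpace ℝ (Fin (n + 1))) = e} = 0 := by
  have hm : MeasurableSet {y : sphere (0 : EuclideanSpace ℝ (Fin (n + 1))) 1 |
      (y : EuclideanSpace ℝ (Fin (n + 1))) = e} :=
    measurableSet_eq_fun (by fun_prop) measurable_const
  rw [Measure.toSphere_apply' _ hm]
  refine mul_eq_zero_of_right _ ?_
  have hs : (Submodule.span ℝ {e}) ≠ ⊤ := by
    intro h
    have h1 := finrank_span_le_card (R := ℝ) ({e} : Set (EuclideanSpace ℝ (Fin (n + 1))))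
    rw [h, finrank_top, finrank_euclideanSpace, Fintype.card_fin] at h1
    simp at h1
    omega
  refine measure_mono_null ?_ (Measure.addHaar_submodule volume _ hs)
  rintro z hz
  obtain ⟨r, _, w, ⟨y, hy, rfl⟩, rfl⟩ := Set.mem_smul.1 hz
  have hy' : (y : EuclideanSpace ℝ (Fin (n + 1))) = e := hy
  rw [hy']
  exact Submodule.smul_mem _ _ (Submodule.mem_span_singleton_self e)

lemma lint_top {a c : ℝ} (ha : 1 < a) (hc : 0 < c) :
    ∫⁻ l in Ioi a, ENNReal.ofReal (c / (l * Real.log l)) = ∞ := by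
  by_contra h
  have hm : Measurable (fun l : ℝ => c / (l * Real.log l)) := by fun_prop
  have hint : IntegrableOn (fun l : ℝ => c / (l * Real.log l)) (Ioi a) := by
    refine (lintegral_ofReal_ne_top_iff_integrable hm.aestronglyMeasurable ?_).1 h
    filter_upwards [ae_restrict_mem measurableSet_Ioi] with l hl
    have hl' : a < l := hl
    have := Real.log_pos (ha.trans hl')
    have : 0 < l := by linarith
    change 0 ≤ _
    positivity
  refine not_integrableOn_of_tendsto_norm_atTop_of_deriv_isBigO_filter
    (f := fun l => Real.log (Real.log l)) atTop (Ioi_mem_atTop a) ?_ ?_ ?_ hint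
  · filter_upwards [eventually_gt_atTop 1] with l hl
    have := Real.log_pos hl
    exact ((Real.differentiableAt_log (by linarith)).log this.ne')
  · exact tendsto_norm_atTop_atTop.comp (Real.tendsto_log_atTop.comp Real.tendsto_log_atTop)
  · refine Asymptotics.IsBigO.of_bound (1 / c) ?_
    filter_upwards [eventually_gt_atTop 1] with l hl
    have h1 := Real.log_pos hl
    have h2 : (0 : ℝ) < l := by linarith
    rw [((Real.hasDerivAt_log h2.ne').log h1.ne').deriv,
      Real.norm_of_nonneg (by positivity), Real.norm_of_nonneg (by positivity)]
    apply le_of_eq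
    field_simp

lemma lint_lt_top {a r : ℝ} (ha : 1 < a) (hr : 1 < r) :
    ∫⁻ l in Ioi a, ENNReal.ofReal (l⁻¹ * (Real.log l) ^ (-r)) < ∞ := by
  have : IntegrableOn (fun l : ℝ => l⁻¹ * (Real.log l) ^ (-r)) (Ioi a) := by
    refine integrableOn_Ioi_deriv_of_nonneg' (g := fun l => - ((Real.log l) ^ (-(r - 1)) / (r - 1)))
      (l := 0) ?_ ?_ ?_
    · intro l hl
      have hl' : a ≤ l := hl
      have h1 := Real.log_pos (ha.trans_le hl')
      have h2 : 0 < l := by linarith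
      have h3 : r - 1 ≠ 0 := by linarith
      convert! (((Real.hasDerivAt_log h2.ne').rpow_const (p := -(r - 1))
        (Or.inl h1.ne')).div_const (r - 1)).neg using 1
      have : -(r - 1) - 1 = -r := by ring
      rw [this]; field_simp
    · intro l hl
      have hl' : a < l := hl
      have h1 := Real.log_pos (ha.trans hl')
      have h2 : 0 < l := by linarith
      positivity
    · have := ((tendsto_rpow_neg_atTop (y := r - 1) (by linarith)).comp
        Real.tendsto_log_atTop).div_const (r - 1) |>.neg
      simpa using this
  exact this.lintegral_lt_top

lemma lorentz_part (n : ℕ) (hn : 1 ≤ n) (r : ℝ) (hr : 1 < r) :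
    lorentzNorm (volume : Measure (EuclideanSpace ℝ (Fin (n + 1))))
      (((n + 1 : ℕ) : ℝ) / (((n + 1 : ℕ) : ℝ) - 1)) r
        (fun x => ENNReal.ofReal (steinF (n + 1) x)) < ∞ := by
  have hn' : (1 : ℝ) ≤ n := by exact_mod_cast hn
  have hq : r / (((n + 1 : ℕ) : ℝ) / (((n + 1 : ℕ) : ℝ) - 1)) = r * n / (n + 1) := by
    push_cast
    rw [add_sub_cancel_right, div_div_eq_mul_div]
  unfold lorentzNorm
  rw [hq]
  set q : ℝ := r * n / (n + 1) with hqdef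
  have hq0 : 0 < q := by positivity
  set V := volume (closedBall (0 : EuclideanSpace ℝ (Fin (n + 1))) 1) with hV
  have hVt : V < ∞ := measure_closedBall_lt_top
  have hVq : V ^ q < ∞ := ENNReal.rpow_lt_top_of_nonneg hq0.le hVt.ne
  apply ENNReal.rpow_lt_top_of_nonneg (by positivity)
  apply ne_of_lt
  set a : ℝ := max 2 (Real.exp (-2 * Real.log (Real.log 2))) with ha
  have ha2 : 2 ≤ a := le_max_left _ _
  have hae : Real.exp (-2 * Real.log (Real.log 2)) ≤ a := le_max_right _ _
  rw [← Ioc_union_Ioi_eq_Ioi (show (0 : ℝ) ≤ a by linarith)]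
  refine lt_of_le_of_lt (lintegral_union_le _ _ _) (ENNReal.add_lt_top.2 ⟨?_, ?_⟩)
  · refine lt_of_le_of_lt (setLIntegral_mono' (g := fun _ => ENNReal.ofReal (a ^ (r - 1)) * V ^ q)
      measurableSet_Ioc ?_) ?_
    · intro l hl
      have hl0 : 0 < l := hl.1
      gcongr
      · exact hl.2
      · refine measure_mono ?_
        intro x hx
        have hx' : ENNReal.ofReal l < ENNReal.ofReal (steinF (n + 1) x) := hx
        have h1 := (ENNReal.ofReal_lt_ofReal_iff'.1 hx').1
        rw [mem_closedBall_zero_iff]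
        by_contra hcon
        push Not at hcon
        rw [steinF_zero _ x (by intro h; linarith [h.2])] at h1
        linarith
    · rw [setLIntegral_const]
      refine ENNReal.mul_lt_top (ENNReal.mul_lt_top ENNReal.ofReal_lt_top hVq) ?_
      simp
  · refine lt_of_le_of_lt (setLIntegral_mono' (g := fun l => ENNReal.ofReal ((2 * n) ^ r) *
      ENNReal.ofReal (l⁻¹ * (Real.log l) ^ (-r)) * V ^ q)
      measurableSet_Ioi ?_) ?_
    · intro l hl
      have hl' : a < l := hl
      have hl0 : 0 < l := by linarith
      have hl1 : 1 < l := by linarith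
      have hll : 0 < Real.log l := Real.log_pos hl1
      have hlog : -2 * Real.log (Real.log 2) ≤ Real.log l := by
        rw [Real.le_log_iff_exp_le hl0]; linarith
      set b : ℝ := 2 * n / (l * Real.log l) with hb
      have hb0 : 0 < b := by positivity
      set R : ℝ := b ^ (1 / (n : ℝ)) with hR
      have hR0 : 0 < R := by positivity
      have hRn : R ^ n = b := by
        rw [hR, one_div, Real.rpow_inv_natCast_pow hb0.le (by omega)]
      have hsub : {x : EuclideanSpace ℝ (Fin (n + 1)) |
          ENNReal.ofReal l < ENNReal.ofReal (steinF (n + 1) x)} ⊆ closedBall 0 R := by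
        intro x hx
        have hx' : ENNReal.ofReal l < ENNReal.ofReal (steinF (n + 1) x) := hx
        have h1 := (ENNReal.ofReal_lt_ofReal_iff'.1 hx').1
        have h2 := steinF_upper n hn x hl1 hlog h1
        rw [mem_closedBall_zero_iff]
        rw [← hb, ← hRn] at h2
        exact le_of_pow_le_pow_left₀ (by omega) hR0.le h2
      have hvol := measure_mono (μ := (volume : Measure (EuclideanSpace ℝ (Fin (n + 1))))) hsub
      rw [Measure.addHaar_closedBall' _ _ hR0.le, finrank_euclideanSpace, Fintype.card_fin] at hvol
      have hpow : (R ^ (n + 1)) ^ q = b ^ r := by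
        rw [hR, ← Real.rpow_natCast, ← Real.rpow_mul hb0.le, ← Real.rpow_mul hb0.le, hqdef]
        congr 1
        push_cast
        field_simp
      calc _ ≤ ENNReal.ofReal (l ^ (r - 1)) * (ENNReal.ofReal (R ^ (n + 1)) * V) ^ q := by
            gcongr
        _ = ENNReal.ofReal (l ^ (r - 1) * b ^ r) * V ^ q := by
            rw [ENNReal.mul_rpow_of_nonneg _ _ hq0.le,
              ENNReal.ofReal_rpow_of_nonneg (by positivity) hq0.le, hpow, ← mul_assoc,
              ENNReal.ofReal_mul (by positivity)]
        _ = _ := by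
            rw [← ENNReal.ofReal_mul (by positivity)]
            congr 2
            rw [hb, Real.div_rpow (by positivity) (by positivity),
              Real.mul_rpow hl0.le hll.le, Real.rpow_sub hl0, Real.rpow_neg hll.le, Real.rpow_one]
            have h1 : 0 < l ^ r := by positivity
            have h2 : 0 < Real.log l ^ r := by positivity
            field_simp
    · rw [lintegral_mul_const' _ _ hVq.ne, lintegral_const_mul' _ _ ENNReal.ofReal_ne_top]
      exact ENNReal.mul_lt_top (ENNReal.mul_lt_top ENNReal.ofReal_lt_top
        (lint_lt_top (by linarith) hr)) hVq

lemma sph_part (n : ℕ) (hn : 1 ≤ n) (x : EuclideanSpace ℝ (Fin (n + 1)))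
    (hx : ‖x‖ ∈ Icc (1 : ℝ) 2) :
    sphMax (n + 1) (Icc (1 : ℝ) 2) (steinF (n + 1)) x = ∞ := by
  suffices h : sphAvg (n + 1) (steinF (n + 1)) ‖x‖ x = ∞ by
    rw [eq_top_iff, ← h]
    exact le_iSup₂_of_le ‖x‖ hx le_rfl
  obtain ⟨hx1, hx2⟩ := hx
  have hx0 : 0 < ‖x‖ := by linarith
  set e : EuclideanSpace ℝ (Fin (n + 1)) := ‖x‖⁻¹ • x with he
  have he1 : ‖e‖ = 1 := by rw [he, norm_smul, norm_inv, norm_norm, inv_mul_cancel₀ hx0.ne']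
  have hxe : ‖x‖ • e = x := by rw [he, smul_smul, mul_inv_cancel₀ hx0.ne', one_smul]
  have hnorm : ∀ y : EuclideanSpace ℝ (Fin (n + 1)), ‖x - ‖x‖ • y‖ = ‖x‖ * ‖e - y‖ := by
    intro y
    nth_rewrite 1 [← hxe]
    rw [← smul_sub, norm_smul, norm_norm]
  unfold sphAvg sphMeasure
  rw [lintegral_smul_measure, smul_eq_mul]
  apply ENNReal.mul_eq_top.2
  refine Or.inl ⟨ENNReal.inv_ne_zero.2 (measure_ne_top _ _), ?_⟩
  set ν := (volume : Measure (EuclideanSpace ℝ (Fin (n + 1)))).toSphere with hν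
  have hmeas : Measurable (fun y : sphere (0 : EuclideanSpace ℝ (Fin (n + 1))) 1 =>
      |steinF (n + 1) (x - ‖x‖ • (y : EuclideanSpace ℝ (Fin (n + 1))))|) := by
    have h1 : Measurable (fun y : sphere (0 : EuclideanSpace ℝ (Fin (n + 1))) 1 =>
      steinF (n + 1) (x - ‖x‖ • (y : EuclideanSpace ℝ (Fin (n + 1))))) :=
      (steinF_measurable (n + 1)).comp (by fun_prop)
    exact continuous_abs.measurable.comp h1
  rw [lintegral_eq_lintegral_meas_lt ν (Eventually.of_forall fun y => abs_nonneg _)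
    hmeas.aemeasurable]
  set a : ℝ := 2 ^ n + 3 with ha
  have hp : (0 : ℝ) < 2 ^ n := by positivity
  set V := volume (ball (0 : EuclideanSpace ℝ (Fin (n + 1))) 1) with hV
  have hV0 : V ≠ 0 := (measure_ball_pos _ _ one_pos).ne'
  have hc : (0 : ℝ) < (1 / 8) ^ n / 16 := by positivity
  have hbig : ∫⁻ l in Ioi a, ENNReal.ofReal (((1 / 8) ^ n / 16) / (l * Real.log l)) * V = ∞ := by
    rw [lintegral_mul_const' _ _ measure_ball_lt_top.ne, lint_top (by linarith) hc]
    exact ENNReal.top_mul hV0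
  rw [eq_top_iff, ← hbig]
  refine le_trans (setLIntegral_mono' measurableSet_Ioi ?_)
    (lintegral_mono_set (Ioi_subset_Ioi (show (0 : ℝ) ≤ a by positivity)))
  intro l hl
  have hl' : a < l := hl
  have hl0 : 0 < l := by linarith
  have hle : Real.exp 1 ≤ l := by have := Real.exp_one_lt_d9; linarith
  have hll : 1 ≤ Real.log l := by rwa [Real.le_log_iff_exp_le hl0]
  set b : ℝ := 1 / (2 * l * Real.log l) with hb
  have hb0 : 0 < b := by positivity
  set R : ℝ := b ^ (1 / (n : ℝ)) with hR
  have hR0 : 0 < R := by positivity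
  have hRn : R ^ n = b := by
    rw [hR, one_div, Real.rpow_inv_natCast_pow hb0.le (by omega)]
  have hR2 : R ≤ 1 / 2 := by
    refine le_of_pow_le_pow_left₀ (n := n) (by omega) (by norm_num) ?_
    rw [hRn, hb, div_pow, one_pow]
    apply one_div_le_one_div_of_le hp
    nlinarith
  have hcap := cap_lower n e he1 (δ := R / 2) (by positivity) (by linarith)
  have hval : (R / 2 / 4) ^ n / 8 = ((1 / 8) ^ n / 16) / (l * Real.log l) := by
    have : R / 2 / 4 = (1 / 8) * R := by ring
    rw [this, mul_pow, hRn, hb]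
    field_simp
    norm_num
  rw [hval] at hcap
  refine le_trans hcap ?_
  have hsub : {y : sphere (0 : EuclideanSpace ℝ (Fin (n + 1))) 1 |
      ‖e - (y : EuclideanSpace ℝ (Fin (n + 1)))‖ < R / 2} ⊆
      {y | l < |steinF (n + 1) (x - ‖x‖ • (y : EuclideanSpace ℝ (Fin (n + 1))))|} ∪
      {y | (y : EuclideanSpace ℝ (Fin (n + 1))) = e} := by
    intro y hy
    have hy' : ‖e - (y : EuclideanSpace ℝ (Fin (n + 1)))‖ < R / 2 := hy
    by_cases hye : (y : EuclideanSpace ℝ (Fin (n + 1))) = e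
    · exact Or.inr hye
    · left
      change l < |steinF (n + 1) (x - ‖x‖ • (y : EuclideanSpace ℝ (Fin (n + 1))))|
      refine lt_of_lt_of_le ?_ (le_abs_self _)
      have h0 : 0 < ‖e - (y : EuclideanSpace ℝ (Fin (n + 1)))‖ :=
        norm_pos_iff.2 (sub_ne_zero.2 (Ne.symm hye))
      have hlt : ‖x - ‖x‖ • (y : EuclideanSpace ℝ (Fin (n + 1)))‖ < R := by
        rw [hnorm]; nlinarith
      apply steinF_lower n hn _ _ (by linarith) hle
      · have h1 : ‖x - ‖x‖ • (y : EuclideanSpace ℝ (Fin (n + 1)))‖ ^ n < b := by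
          rw [← hRn]
          exact pow_lt_pow_left₀ hlt (norm_nonneg _) (by omega)
        rwa [hb, lt_div_iff₀ (by positivity)] at h1
      · rw [hnorm]; positivity
  calc _ ≤ _ := measure_mono hsub
    _ ≤ _ := measure_union_le _ _
    _ = _ := by rw [point_null n hn e, add_zero]

theorem stein_counterexample (d : ℕ) (hd : 2 ≤ d) :
    (∀ r : ℝ, 1 < r →
      lorentzNorm (volume : Measure (EuclideanSpace ℝ (Fin d))) ((d : ℝ) / (d - 1)) r
        (fun x => ENNReal.ofReal (steinF d x)) < ∞) ∧
    (∀ x : EuclideanSpace ℝ (Fin d), ‖x‖ ∈ Icc (1 : ℝ) 2 →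
      sphMax d (Icc (1 : ℝ) 2) (steinF d) x = ∞) := by
  obtain ⟨n, rfl⟩ : ∃ n, d = n + 1 := ⟨d - 1, by omega⟩
  have hn : 1 ≤ n := by omega
  exact ⟨fun r hr => lorentz_part n hn r hr, fun x hx => sph_part n hn x hx⟩
end
end

section
/- Two-dimensional restricted-weak-type necessary condition: let d = 2 and E ⊆ [1,2], and suppose M_E maps L^{p,1}_{rad}(ℝ²) boundedly to L^{q,∞}(ℝ²). Then for every interval I ⊆ [1,2] and every δ with 0 < δ ≤ |I| ≤ 1, δ^{1/2 + 1/q}·|I|^{1/q − 1/2}·N(E ∩ I, δ)^{1/q} ≤ C·δ^{1/p}, where N(E∩I, δ) is the minimal number of intervals of length δ covering E ∩ I. -/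
open Set MeasureTheory Metric
open scoped ENNReal NNReal

noncomputable section

/-- Minimal number of (closed) intervals of length `a` needed to cover `E`. -/
def coverNum (E : Set ℝ) (a : ℝ) : ℕ :=
  sInf {n : ℕ | ∃ s : Finset ℝ, s.card = n ∧ E ⊆ ⋃ c ∈ s, Icc c (c + a)}

/-- The normalized surface measure on the unit circle of `ℝ²`. -/
def sphMeasure2 : Measure (sphere (0 : EuclideanSpace ℝ (Fin 2)) 1) :=
  (((volume : Measure (EuclideanSpace ℝ (Fin 2))).toSphere univ)⁻¹) •
    (volume : Measure (EuclideanSpace ℝ (Fin 2))).toSphere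

/-- Circular average (of the absolute value) at radius `t`. -/
def circAvg (f : EuclideanSpace ℝ (Fin 2) → ℝ) (t : ℝ)
    (x : EuclideanSpace ℝ (Fin 2)) : ℝ≥0∞ :=
  ∫⁻ y : sphere (0 : EuclideanSpace ℝ (Fin 2)) 1,
    ENNReal.ofReal |f (x - t • (y : EuclideanSpace ℝ (Fin 2)))| ∂sphMeasure2

/-- Circular maximal operator over the dilation set `E`. -/
def circMax (E : Set ℝ) (f : EuclideanSpace ℝ (Fin 2) → ℝ)
    (x : EuclideanSpace ℝ (Fin 2)) : ℝ≥0∞ :=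
  ⨆ t ∈ E, circAvg f t x

/-- The weak `L^q(μ)` (Lorentz `L^{q,∞}`) quasinorm of an `ℝ≥0∞`-valued function. -/
def wnormE {α : Type*} [MeasurableSpace α] (μ : Measure α) (q : ℝ)
    (g : α → ℝ≥0∞) : ℝ≥0∞ :=
  ⨆ l : ℝ≥0, (l : ℝ≥0∞) * (μ {x | (l : ℝ≥0∞) < g x}) ^ (1 / q)

/-- The Lorentz `L^{p,1}(μ)` norm of a real function. -/
def lorentz1 {α : Type*} [MeasurableSpace α] (μ : Measure α) (p : ℝ)
    (f : α → ℝ) : ℝ≥0∞ :=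
  ∫⁻ l in Ioi (0 : ℝ), (μ {x | l < |f x|}) ^ (1 / p)


abbrev PlaneE := EuclideanSpace ℝ (Fin 2)

open scoped Pointwise in
lemma cap_rect (e : PlaneE) (he : ‖e‖ = 1) (ρ : ℝ) (hρ : 0 < ρ) (hρ1 : ρ ≤ 1) :
    ENNReal.ofReal (ρ / 16) ≤ (volume : Measure PlaneE)
      (Ioo (0 : ℝ) 1 • ((Subtype.val : sphere (0 : PlaneE) 1 → PlaneE) ''
        {y : sphere (0 : PlaneE) 1 | ‖(y : PlaneE) - e‖ ≤ ρ})) := by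
  have hv : Orthonormal ℝ (({0} : Set (Fin 2)).domRestrict (fun _ => e)) := by
    rw [orthonormal_iff_ite]
    rintro ⟨i, hi⟩ ⟨j, hj⟩
    simp only [mem_singleton_iff] at hi hj
    subst hi; subst hj
    simp [he]
  obtain ⟨b, hb⟩ := hv.exists_orthonormalBasis_extension_of_card_eq (by simp)
  have hb0 : b 0 = e := hb 0 rfl
  have hmp : MeasurePreserving (fun z : PlaneE => (b.repr z).ofLp) :=
    (PiLp.volume_preserving_ofLp (Fin 2)).comp b.measurePreserving_repr
  set R : Set (Fin 2 → ℝ) := pi univ fun i => Ioo ((![1/4, -(ρ/8)] : Fin 2 → ℝ) i)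
    ((![1/2, ρ/8] : Fin 2 → ℝ) i) with hR
  have hvol : volume R = ENNReal.ofReal (ρ / 16) := by
    rw [hR, Real.volume_pi_Ioo, Fin.prod_univ_two, ← ENNReal.ofReal_mul]
    · congr 1; simp; ring
    · simp; norm_num
  have hRm : MeasurableSet R := MeasurableSet.univ_pi (fun i => measurableSet_Ioo)
  rw [← hvol, ← hmp.measure_preimage hRm.nullMeasurableSet]
  apply measure_mono
  intro z hz
  have h0 := hz 0 (mem_univ _)
  have h1 := hz 1 (mem_univ _)
  simp only [Matrix.cons_val_zero, Matrix.cons_val_one, mem_Ioo] at h0 h1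
  set α := (b.repr z).ofLp 0 with hα
  set β := (b.repr z).ofLp 1 with hβ
  have hn : ‖z‖ ^ 2 = α ^ 2 + β ^ 2 := by
    rw [← b.repr.norm_map z, EuclideanSpace.norm_sq_eq, Fin.sum_univ_two]
    simp [hα, hβ]
  have hin : inner ℝ z e = α := by
    rw [hα, b.repr_apply_apply, hb0, real_inner_comm]
  have hzp : 1 / 4 < ‖z‖ := by
    by_contra h
    push Not at h
    nlinarith [norm_nonneg z]
  have hza : α ≤ ‖z‖ := by
    by_contra h
    push Not at h
    nlinarith [norm_nonneg z]
  have hz1 : ‖z‖ < 1 := by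
    by_contra h
    push Not at h
    nlinarith [norm_nonneg z]
  have hz0 : ‖z‖ ≠ 0 := by linarith
  refine Set.mem_smul.2 ⟨‖z‖, ⟨by linarith, hz1⟩, ‖z‖⁻¹ • z, ?_, ?_⟩
  · have hs : ‖‖z‖⁻¹ • z‖ = 1 := by
      rw [norm_smul, norm_inv, norm_norm, inv_mul_cancel₀ hz0]
    refine ⟨⟨‖z‖⁻¹ • z, by simpa using hs⟩, ?_, rfl⟩
    simp only [mem_ofPred_eq]
    refine (sq_le_sq₀ (norm_nonneg _) hρ.le).1 ?_
    rw [norm_sub_sq_real, hs, he, inner_smul_left, hin]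
    simp only [conj_trivial]
    have : ‖z‖⁻¹ * α = α / ‖z‖ := by ring
    rw [this]
    have h2 : 1 - ρ ^ 2 / 2 ≤ α / ‖z‖ := by
      rw [le_div_iff₀ (by linarith)]
      have hβ2 : β ^ 2 ≤ (ρ / 8) ^ 2 := by nlinarith
      have h3 : (‖z‖ - α) * (‖z‖ + α) ≤ (ρ / 8) ^ 2 := by nlinarith
      have h4 : (‖z‖ - α) * (1 / 4) ≤ (‖z‖ - α) * (‖z‖ + α) := by
        apply mul_le_mul_of_nonneg_left <;> linarith
      nlinarith
    linarith
  · rw [smul_smul, mul_inv_cancel₀ hz0, one_smul]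

lemma cap_lower_s17 : ∃ κ : ℝ, 0 < κ ∧ ∀ e : PlaneE, ‖e‖ = 1 → ∀ ρ : ℝ, 0 < ρ → ρ ≤ 1 →
    ENNReal.ofReal (κ * ρ) ≤
      sphMeasure2 {y : sphere (0 : PlaneE) 1 | ‖(y : PlaneE) - e‖ ≤ ρ} := by
  refine ⟨1 / (32 * Real.pi), by positivity, fun e he ρ hρ hρ1 => ?_⟩
  have hm : MeasurableSet {y : sphere (0 : PlaneE) 1 | ‖(y : PlaneE) - e‖ ≤ ρ} :=
    measurableSet_le (by fun_prop) (by fun_prop)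
  rw [sphMeasure2, Measure.smul_apply, Measure.toSphere_apply' _ hm, Measure.toSphere_apply_univ,
    EuclideanSpace.volume_ball_fin_two, smul_eq_mul, finrank_euclideanSpace_fin]
  have h := cap_rect e he ρ hρ hρ1
  calc ENNReal.ofReal (1 / (32 * Real.pi) * ρ)
      = (((2 : ℕ) : ℝ≥0∞) * (ENNReal.ofReal 1 ^ 2 * ENNReal.ofReal Real.pi))⁻¹ *
          (ENNReal.ofReal (ρ / 16)) := by
        have : ((2 : ℕ) : ℝ≥0∞) = ENNReal.ofReal 2 := by simp
        rw [this, ENNReal.ofReal_one, one_pow, one_mul, ← ENNReal.ofReal_mul (by norm_num),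
          ← ENNReal.ofReal_inv_of_pos (by positivity), ← ENNReal.ofReal_mul (by positivity)]
        congr 1
        field_simp
        norm_num
    _ ≤ _ := by
        gcongr
        refine h.trans ?_
        refine le_mul_of_one_le_left zero_le (by norm_num)

lemma avg_lower (w η κ ρ t : ℝ) (x : PlaneE) (ht : 0 < t) (hx : x ≠ 0)
    (hw : |t + ‖x‖ - w| ≤ η) (hρ : 0 < ρ) (hρ1 : ρ ≤ 1) (hr : ‖x‖ * ρ ^ 2 ≤ η)
    (hκ : ∀ e : PlaneE, ‖e‖ = 1 → ∀ ρ : ℝ, 0 < ρ → ρ ≤ 1 →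
    ENNReal.ofReal (κ * ρ) ≤
      sphMeasure2 {y : sphere (0 : PlaneE) 1 | ‖(y : PlaneE) - e‖ ≤ ρ}) :
    ENNReal.ofReal (κ * ρ) ≤
      circAvg ({z : PlaneE | |‖z‖ - w| ≤ 2 * η}.indicator (fun _ => (1 : ℝ))) t x := by
  have hx0 : 0 < ‖x‖ := norm_pos_iff.2 hx
  have he : ‖-(‖x‖⁻¹ • x)‖ = 1 := by
    rw [norm_neg, norm_smul, norm_inv, norm_norm, inv_mul_cancel₀ hx0.ne']
  refine (hκ _ he ρ hρ hρ1).trans ?_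
  have hm : MeasurableSet {y : sphere (0 : PlaneE) 1 | ‖(y : PlaneE) - (-(‖x‖⁻¹ • x))‖ ≤ ρ} :=
    measurableSet_le (by fun_prop) (by fun_prop)
  rw [circAvg, ← lintegral_indicator_one hm]
  apply lintegral_mono
  apply indicator_le (fun y hy => ?_)
  simp only [mem_ofPred_eq] at hy
  have hy1 : ‖(y : PlaneE)‖ = 1 := by simp
  set Y : PlaneE := (y : PlaneE)
  suffices hmem : |‖x - t • Y‖ - w| ≤ 2 * η by
    rw [indicator_of_mem (by exact hmem)]; simp
  have hsq : ‖x - t • Y‖ ^ 2 = ‖x‖ ^ 2 - 2 * (t * inner ℝ x Y) + t ^ 2 := by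
    rw [norm_sub_sq_real, norm_smul, hy1, inner_smul_right, mul_one, Real.norm_eq_abs, sq_abs]
  have hcap : ‖Y - -(‖x‖⁻¹ • x)‖ ^ 2 = 2 + 2 * (‖x‖⁻¹ * inner ℝ x Y) := by
    rw [norm_sub_sq_real, he, hy1, inner_neg_right, inner_smul_right, real_inner_comm]
    ring
  have hc2 : 2 + 2 * (‖x‖⁻¹ * inner ℝ x Y) ≤ ρ ^ 2 := by
    rw [← hcap]; gcongr
  have hc3 : 2 * ‖x‖ + 2 * inner ℝ x Y ≤ ‖x‖ * ρ ^ 2 := by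
    have := mul_le_mul_of_nonneg_left hc2 hx0.le
    have h2 : ‖x‖ * (2 + 2 * (‖x‖⁻¹ * inner ℝ x Y)) = 2 * ‖x‖ + 2 * inner ℝ x Y := by
      field_simp
    linarith
  have hup : ‖x - t • Y‖ ≤ t + ‖x‖ := by
    have := norm_sub_le x (t • Y)
    rw [norm_smul, hy1, mul_one, Real.norm_eq_abs, abs_of_pos ht] at this
    linarith
  have hlow : t + ‖x‖ - η ≤ ‖x - t • Y‖ := by
    by_contra h
    push Not at h
    have hs0 := norm_nonneg (x - t • Y)
    have h1 : t * (2 * ‖x‖ + 2 * inner ℝ x Y) ≤ t * η :=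
      mul_le_mul_of_nonneg_left (hc3.trans hr) ht.le
    have hη : 0 < η := lt_of_lt_of_le (by positivity) hr
    nlinarith
  rw [abs_le] at hw ⊢
  constructor <;> linarith

lemma annulus_lower (a b : ℝ) (ha : 0 ≤ a) (hab : a ≤ b) :
    ENNReal.ofReal ((b - a) * a) ≤ (volume : Measure PlaneE) {x | a < ‖x‖ ∧ ‖x‖ ≤ b} := by
  have hset : {x : PlaneE | a < ‖x‖ ∧ ‖x‖ ≤ b} = closedBall 0 b \ closedBall 0 a := by
    ext x; simp [and_comm]
  rw [hset, measure_sdiff (closedBall_subset_closedBall hab) measurableSet_closedBall.nullMeasurableSet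
    (measure_closedBall_lt_top.ne), EuclideanSpace.volume_closedBall_fin_two,
    EuclideanSpace.volume_closedBall_fin_two, ← ENNReal.ofReal_pow ha,
    ← ENNReal.ofReal_pow (ha.trans hab), ← ENNReal.ofReal_mul (by positivity),
    ← ENNReal.ofReal_mul (by positivity), ← ENNReal.ofReal_sub _ (by positivity)]
  apply ENNReal.ofReal_le_ofReal
  have hpi := Real.pi_gt_three
  have h1 : (b - a) * a ≤ b ^ 2 - a ^ 2 := by nlinarith
  have h2 : 0 ≤ b ^ 2 - a ^ 2 := by nlinarith
  nlinarith

lemma annulus_upper (w h : ℝ) (hh : 0 ≤ h) (hw : h ≤ w) :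
    (volume : Measure PlaneE) {x | |‖x‖ - w| ≤ h} ≤ ENNReal.ofReal (4 * Real.pi * w * h) := by
  have hset : {x : PlaneE | |‖x‖ - w| ≤ h} = closedBall 0 (w + h) \ ball 0 (w - h) := by
    ext x
    simp only [mem_ofPred_eq, mem_sdiff, mem_closedBall, mem_ball, dist_zero_right, not_lt, abs_le]
    constructor <;> rintro ⟨h1, h2⟩ <;> constructor <;> linarith
  have h0 : 0 ≤ w - h := by linarith
  rw [hset, measure_sdiff (ball_subset_closedBall.trans (closedBall_subset_closedBall (by linarith)))
    measurableSet_ball.nullMeasurableSet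
    (measure_ball_lt_top.ne), EuclideanSpace.volume_closedBall_fin_two,
    EuclideanSpace.volume_ball_fin_two, ← ENNReal.ofReal_pow h0,
    ← ENNReal.ofReal_pow (by linarith), ← ENNReal.ofReal_mul (by positivity),
    ← ENNReal.ofReal_mul (by positivity), ← ENNReal.ofReal_sub _ (by positivity)]
  apply ENNReal.ofReal_le_ofReal
  apply le_of_eq
  ring

lemma lorentz_ind (p : ℝ) (hp : 1 ≤ p) (S : Set PlaneE) :
    lorentz1 (volume : Measure PlaneE) p (S.indicator (fun _ => (1 : ℝ))) ≤
      volume S ^ (1 / p) := by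
  have hp0 : 0 < 1 / p := by positivity
  have : ∀ l ∈ Ioi (0 : ℝ), (volume {x : PlaneE | l < |S.indicator (fun _ => (1 : ℝ)) x|}) ^ (1 / p) ≤
      (Iio (1 : ℝ)).indicator (fun _ => volume S ^ (1 / p)) l := by
    intro l hl
    by_cases h1 : l < 1
    · rw [indicator_of_mem (by exact h1)]
      gcongr
      intro x hx
      by_contra hxS
      simp only [mem_ofPred_eq, indicator_of_notMem hxS, abs_zero] at hx
      exact absurd hl (not_lt.2 hx.le)
    · have : {x : PlaneE | l < |S.indicator (fun _ => (1 : ℝ)) x|} = ∅ := by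
        ext x
        simp only [mem_ofPred_eq, mem_empty_iff_false, iff_false, not_lt]
        by_cases hxS : x ∈ S
        · simp [hxS]; linarith
        · simp [hxS]; exact le_of_lt hl
      rw [this]
      rw [measure_empty, ENNReal.zero_rpow_of_pos hp0]
      exact zero_le
  rw [lorentz1]
  refine (setLIntegral_mono' measurableSet_Ioi this).trans ?_
  rw [lintegral_indicator measurableSet_Iio, Measure.restrict_restrict measurableSet_Iio,
    setLIntegral_const]
  have : Iio (1 : ℝ) ∩ Ioi 0 = Ioo 0 1 := by ext; simp [and_comm]
  simp [this]

lemma level_lower (E : Set ℝ) (u v δ : ℝ) (hu : 1 ≤ u) (hv : v ≤ 2) (hδ : 0 < δ)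
    (hδI : δ ≤ v - u) (κ : ℝ)
    (hκ : ∀ e : PlaneE, ‖e‖ = 1 → ∀ ρ : ℝ, 0 < ρ → ρ ≤ 1 →
    ENNReal.ofReal (κ * ρ) ≤
      sphMeasure2 {y : sphere (0 : PlaneE) 1 | ‖(y : PlaneE) - e‖ ≤ ρ})
    (ρ : ℝ) (hρ : 0 < ρ) (hρ1 : ρ ≤ 1) (hρI : 4 * (v - u) * ρ ^ 2 ≤ δ) :
    ENNReal.ofReal (coverNum (E ∩ Icc u v) δ * (δ * (v - u))) ≤
      (volume : Measure PlaneE) {x | ENNReal.ofReal (κ * ρ) ≤ circMax E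
        ({z : PlaneE | |‖z‖ - (v + 2 * (v - u))| ≤ 2 * δ}.indicator (fun _ => (1 : ℝ))) x} := by
  set w := v + 2 * (v - u) with hw
  have hfin : ((fun t : ℝ => ⌊t / δ⌋) '' (E ∩ Icc u v)).Finite := by
    apply (Set.finite_Icc ⌊u / δ⌋ ⌊v / δ⌋).subset
    rintro _ ⟨t, ⟨-, ht1, ht2⟩, rfl⟩
    constructor <;> exact Int.floor_le_floor (by gcongr)
  set K := hfin.toFinset with hK
  have hcov : coverNum (E ∩ Icc u v) δ ≤ K.card := by
    refine le_trans (Nat.sInf_le ⟨K.image (fun k : ℤ => (k : ℝ) * δ), rfl, ?_⟩)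
      Finset.card_image_le
    intro t ht
    simp only [mem_iUnion]
    refine ⟨(⌊t / δ⌋ : ℝ) * δ, Finset.mem_image.2 ⟨⌊t / δ⌋, ?_, rfl⟩, ?_, ?_⟩
    · rw [hK, hfin.mem_toFinset]; exact ⟨t, ht, rfl⟩
    · rw [← le_div_iff₀ hδ]; exact Int.floor_le _
    · have := (Int.lt_floor_add_one (t / δ)).le
      rw [div_le_iff₀ hδ] at this
      linarith
  let A : ℤ → Set PlaneE := fun k => {x | w - (k + 1) * δ < ‖x‖ ∧ ‖x‖ ≤ w - k * δ}
  have hAm : ∀ k, MeasurableSet (A k) := by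
    intro k
    have h1 : MeasurableSet {x : PlaneE | w - (k + 1) * δ < ‖x‖} :=
      measurableSet_lt (by fun_prop) (by fun_prop)
    have h2 : MeasurableSet {x : PlaneE | ‖x‖ ≤ w - k * δ} :=
      measurableSet_le (by fun_prop) (by fun_prop)
    exact h1.inter h2
  have hdisj : (K : Set ℤ).PairwiseDisjoint A := by
    intro i _ j _ hij
    rw [Function.onFun, Set.disjoint_left]
    rintro x ⟨h1, h2⟩ ⟨h3, h4⟩
    apply hij
    have h5 : (i : ℝ) < j + 1 := by
      by_contra h; push Not at h; nlinarith
    have h6 : (j : ℝ) < i + 1 := by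
      by_contra h; push Not at h; nlinarith
    have h5' : i < j + 1 := by exact_mod_cast h5
    have h6' : j < i + 1 := by exact_mod_cast h6
    omega
  have hAk : ∀ k ∈ K, ∃ t ∈ E ∩ Icc u v, (k : ℝ) * δ ≤ t ∧ t < (k + 1) * δ := by
    intro k hk
    rw [hK, hfin.mem_toFinset] at hk
    obtain ⟨t, ht, rfl⟩ := hk
    refine ⟨t, ht, ?_, ?_⟩
    · rw [← le_div_iff₀ hδ]; exact Int.floor_le _
    · rw [← div_lt_iff₀ hδ]; exact Int.lt_floor_add_one _
  have hAvol : ∀ k ∈ K, ENNReal.ofReal (δ * (v - u)) ≤ (volume : Measure PlaneE) (A k) := by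
    intro k hk
    obtain ⟨t, ⟨-, ht1, ht2⟩, h1, h2⟩ := hAk k hk
    refine le_trans ?_ (annulus_lower (w - (k + 1) * δ) (w - k * δ) (by linarith) (by linarith))
    apply ENNReal.ofReal_le_ofReal
    have : w - k * δ - (w - (k + 1) * δ) = δ := by ring
    rw [this]
    apply mul_le_mul_of_nonneg_left _ hδ.le
    linarith
  calc ENNReal.ofReal (coverNum (E ∩ Icc u v) δ * (δ * (v - u)))
      ≤ ENNReal.ofReal (K.card * (δ * (v - u))) := by
        apply ENNReal.ofReal_le_ofReal
        have : 0 ≤ v - u := by linarith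
        gcongr
    _ = ∑ k ∈ K, ENNReal.ofReal (δ * (v - u)) := by
        rw [ENNReal.ofReal_mul (by positivity)]; simp
    _ ≤ ∑ k ∈ K, (volume : Measure PlaneE) (A k) := Finset.sum_le_sum hAvol
    _ = volume (⋃ k ∈ K, A k) := (measure_biUnion_finset hdisj (fun k _ => hAm k)).symm
    _ ≤ _ := by
        apply measure_mono
        intro x hx
        simp only [mem_iUnion] at hx
        obtain ⟨k, hk, hx1, hx2⟩ := hx
        obtain ⟨t, ⟨htE, ht1, ht2⟩, h1, h2⟩ := hAk k hk
        have hx0 : 0 < ‖x‖ := by linarith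
        have hx4 : ‖x‖ ≤ 4 * (v - u) := by linarith
        have hxρ : ‖x‖ * ρ ^ 2 ≤ δ := le_trans (by gcongr) hρI
        refine (avg_lower w δ κ ρ t x (by linarith) (norm_pos_iff.1 hx0) ?_ hρ hρ1 hxρ hκ).trans ?_
        · rw [abs_le]; constructor <;> linarith
        · exact le_iSup₂ (f := fun t (_ : t ∈ E) => circAvg _ t x) t htE

theorem twoD_restricted_weak_type_necessary (E : Set ℝ) (hE : E ⊆ Icc (1 : ℝ) 2)
    (p q : ℝ) (hp : 1 ≤ p) (hq : 1 ≤ q) (C : ℝ≥0)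
    (hbound : ∀ f : EuclideanSpace ℝ (Fin 2) → ℝ, Measurable f →
      (∀ x y, ‖x‖ = ‖y‖ → f x = f y) →
      wnormE (volume : Measure (EuclideanSpace ℝ (Fin 2))) q (circMax E f) ≤
        C * lorentz1 (volume : Measure (EuclideanSpace ℝ (Fin 2))) p f) :
    ∃ C' : ℝ, 0 < C' ∧ ∀ u v δ : ℝ, Icc u v ⊆ Icc (1 : ℝ) 2 → 0 < δ → δ ≤ v - u →
      v - u ≤ 1 →
      δ ^ (1 / 2 + 1 / q) * (v - u) ^ (1 / q - 1 / 2) *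
          (coverNum (E ∩ Icc u v) δ : ℝ) ^ (1 / q) ≤ C' * δ ^ (1 / p) := by
  obtain ⟨κ, hκ0, hκ⟩ := cap_lower_s17
  refine ⟨4 / κ * (C * (64 * Real.pi) ^ (1 / p)) + 1, by positivity, ?_⟩
  intro u v δ hI hδ hδI hI1
  have huv : u ≤ v := by linarith
  have hu : 1 ≤ u := (hI (left_mem_Icc.2 huv)).1
  have hv : v ≤ 2 := (hI (right_mem_Icc.2 huv)).2
  have hL : 0 < v - u := by linarith
  set L := v - u with hLdef
  set N : ℝ := (coverNum (E ∩ Icc u v) δ : ℝ) with hN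
  have hN0 : 0 ≤ N := by positivity
  set ρ : ℝ := (δ / L) ^ (1 / 2 : ℝ) / 2 with hρ
  have hρ0 : 0 < ρ := by positivity
  have hsq : ((δ / L) ^ (1 / 2 : ℝ)) ^ 2 = δ / L := by
    rw [← Real.sqrt_eq_rpow, Real.sq_sqrt (by positivity)]
  have hρ2 : 4 * L * ρ ^ 2 = δ := by
    rw [hρ, div_pow, hsq]; field_simp; norm_num
  have hρ1 : ρ ≤ 1 := by
    by_contra h
    push Not at h
    have h2 : 1 ≤ ρ ^ 2 := by nlinarith
    have h3 : L * 1 ≤ L * ρ ^ 2 := mul_le_mul_of_nonneg_left h2 hL.le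
    linarith
  have hlev := level_lower E u v δ hu hv hδ hδI κ hκ ρ hρ0 hρ1 hρ2.le
  set S : Set PlaneE := {z : PlaneE | |‖z‖ - (v + 2 * (v - u))| ≤ 2 * δ} with hS
  have hSm : MeasurableSet S := measurableSet_le (by fun_prop) (by fun_prop)
  have hb := hbound (S.indicator (fun _ => (1 : ℝ))) (measurable_const.indicator hSm) (by
    intro x y hxy
    have : x ∈ S ↔ y ∈ S := by simp only [hS, mem_ofPred_eq, hxy]
    by_cases hx : x ∈ S
    · rw [indicator_of_mem hx, indicator_of_mem (this.1 hx)]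
    · rw [indicator_of_notMem hx, indicator_of_notMem (fun h => hx (this.2 h))])
  have hlor : lorentz1 (volume : Measure PlaneE) p (S.indicator (fun _ => (1 : ℝ))) ≤
      ENNReal.ofReal ((64 * Real.pi * δ) ^ (1 / p)) := by
    refine (lorentz_ind p hp S).trans ?_
    rw [← ENNReal.ofReal_rpow_of_nonneg (by positivity) (by positivity)]
    gcongr
    refine (annulus_upper _ (2 * δ) (by linarith) (by linarith)).trans ?_
    apply ENNReal.ofReal_le_ofReal
    have h4 : v + 2 * (v - u) ≤ 4 := by linarith
    have : 4 * Real.pi * (v + 2 * (v - u)) * (2 * δ) ≤ 4 * Real.pi * 4 * (2 * δ) := by gcongr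
    nlinarith [Real.pi_pos, mul_pos Real.pi_pos hδ]
  have hweak : ENNReal.ofReal (κ * ρ / 2 * (N * (δ * L)) ^ (1 / q)) ≤
      wnormE (volume : Measure PlaneE) q (circMax E (S.indicator (fun _ => (1 : ℝ)))) := by
    refine le_trans ?_ (le_iSup _ (Real.toNNReal (κ * ρ / 2)))
    rw [ENNReal.ofReal_mul (by positivity), ENNReal.ofReal]
    gcongr
    rw [← ENNReal.ofReal_rpow_of_nonneg (by positivity) (by positivity)]
    gcongr
    refine hlev.trans (measure_mono ?_)
    intro x hx
    rw [mem_ofPred_eq] at hx ⊢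
    refine lt_of_lt_of_le ?_ hx
    change ENNReal.ofReal _ < _
    have : 0 < κ * ρ := by positivity
    exact (ENNReal.ofReal_lt_ofReal_iff this).2 (by linarith)
  have hmain : κ * ρ / 2 * (N * (δ * L)) ^ (1 / q) ≤ C * (64 * Real.pi * δ) ^ (1 / p) := by
    have h := hweak.trans (hb.trans (mul_le_mul_right hlor _))
    rw [← ENNReal.ofReal_coe_nnreal, ← ENNReal.ofReal_mul (by positivity)] at h
    exact (ENNReal.ofReal_le_ofReal_iff (by positivity)).1 h
  have hlhs : δ ^ (1 / 2 + 1 / q) * L ^ (1 / q - 1 / 2) * N ^ (1 / q) =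
      4 / κ * (κ * ρ / 2 * (N * (δ * L)) ^ (1 / q)) := by
    rw [hρ, Real.mul_rpow hN0 (by positivity), Real.mul_rpow hδ.le hL.le,
      Real.div_rpow hδ.le hL.le, Real.rpow_add hδ, Real.rpow_sub hL]
    field_simp
    ring
  rw [hlhs]
  rw [Real.mul_rpow (by positivity) hδ.le] at hmain
  have h4 : 0 < 4 / κ := by positivity
  have h5 := mul_le_mul_of_nonneg_left hmain h4.le
  have h6 : 0 < δ ^ (1 / p) := by positivity
  nlinarith
end
end
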